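/- arXiv:2404.09409 — 2 statements merged into one kernel-verified Lean document; each statement's English description precedes it below -/
import Mathlib

section
/- In the Lévy model with coupled free energy F_N(t,λ): for any λ > 0, any t > −ln(α−1), and any 1 < b < α/(1+e^{−t}), one has F_N(t,λ) − F_N(∞,λ) ≤ (2Nβ²/a_N²) · (1−e^{−t})^{−1} · (E|J|^{b/(b−1)})^{2(b−1)/b} · (E|ρ(J)|^{b(1+e^{−t})})^{2/((1+e^{−t})b)}, where J is a standard Gaussian random variable. -/
open MeasureTheory ProbabilityTheory Real Finset

noncomputable section

/-! ### Basic objects: spins, Hermite polynomials, Gaussian measures -/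

/-- The `±1` spin value attached to a Boolean. -/
def spin (b : Bool) : ℝ := if b then 1 else -1

/-- Normalized Hermite polynomial `h_m = He_m / √(m!)`,
orthonormal w.r.t. the standard Gaussian measure. -/
def hermiteFn (m : ℕ) (x : ℝ) : ℝ :=
  Polynomial.aeval x (Polynomial.hermite m) / Real.sqrt (Nat.factorial m)

/-- The law of a family of i.i.d. standard Gaussians over a finite index set. -/
def gaussianPi (ι : Type*) [Fintype ι] : Measure (ι → ℝ) :=
  Measure.pi fun _ => gaussianReal 0 1

instance (ι : Type*) [Fintype ι] : IsProbabilityMeasure (gaussianPi ι) := by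
  unfold gaussianPi; infer_instance

/-- Tensorized normalized Hermite polynomial `h_n(x) = ∏_e h_{n_e}(x_e)`. -/
def hermiteProd {ι : Type*} [Fintype ι] (n : ι → ℕ) (x : ι → ℝ) : ℝ :=
  ∏ e, hermiteFn (n e) (x e)

/-- Continuous perturbation `J(t) = e^{-t} J + √(1-e^{-2t}) J'` of the disorder. -/
def contPerturb {ι : Type*} (t : ℝ) (J J' : ι → ℝ) : ι → ℝ := fun e =>
  Real.exp (-t) * J e + Real.sqrt (1 - Real.exp (-2 * t)) * J' e

/-- Discrete perturbation `J(t)_e = B_e J_e + (1-B_e) J'_e` of the disorder. -/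
def discPerturb {ι : Type*} (J J' : ι → ℝ) (B : ι → Bool) : ι → ℝ := fun e =>
  if B e then J e else J' e

/-- Bernoulli measure on `Bool` with success probability `p`. -/
def berBool (p : ℝ) : Measure Bool :=
  ENNReal.ofReal p • Measure.dirac true + ENNReal.ofReal (1 - p) • Measure.dirac false

instance (p : ℝ) : IsFiniteMeasure (berBool p) := by
  constructor
  simp only [berBool, Measure.coe_add, Pi.add_apply, Measure.smul_apply, smul_eq_mul,
    Measure.dirac_apply' _ MeasurableSet.univ, Set.indicator_univ, Pi.one_apply, mul_one]
  exact ENNReal.add_lt_top.mpr ⟨ENNReal.ofReal_lt_top, ENNReal.ofReal_lt_top⟩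

/-- Product Gaussian measure for a pair `(J, J')` of independent disorders. -/
def pairGauss (ι : Type*) [Fintype ι] : Measure ((ι → ℝ) × (ι → ℝ)) :=
  (gaussianPi ι).prod (gaussianPi ι)

/-- Product Gaussian measure for a triple of independent disorders. -/
def tripleGauss (ι : Type*) [Fintype ι] : Measure ((ι → ℝ) × (ι → ℝ) × (ι → ℝ)) :=
  (gaussianPi ι).prod ((gaussianPi ι).prod (gaussianPi ι))

/-- Law of `(J, J', B)`: two independent Gaussian disorders together with i.i.d.
Bernoulli(`p`) variables. -/
def tripleGaussBer (ι : Type*) [Fintype ι] (p : ℝ) :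
    Measure ((ι → ℝ) × (ι → ℝ) × (ι → Bool)) :=
  (gaussianPi ι).prod ((gaussianPi ι).prod (Measure.pi fun _ => berBool p))

/-! ### Spin models on hypergraphs -/

variable {N : ℕ}

/-- `σ_e = ∏_{v ∈ e} σ_v`. -/
def sigEdge (σ : Fin N → Bool) (e : Finset (Fin N)) : ℝ := ∏ v ∈ e, spin (σ v)

/-- Hamiltonian `H_J(σ) = Σ_e ρ_{|e|}(J_e) σ_e` of the short-range model. -/
def ham (Edges : Finset (Finset (Fin N))) (ρ : ℕ → ℝ → ℝ)
    (J : Finset (Fin N) → ℝ) (σ : Fin N → Bool) : ℝ :=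
  ∑ e ∈ Edges, ρ e.card (J e) * sigEdge σ e

/-- Gibbs average of an observable `f` for the Hamiltonian `H` at inverse temperature `β`. -/
def gibbs (β : ℝ) (H : (Fin N → Bool) → ℝ) (f : (Fin N → Bool) → ℝ) : ℝ :=
  (∑ σ : Fin N → Bool, f σ * Real.exp (β * H σ)) / ∑ σ : Fin N → Bool, Real.exp (β * H σ)

/-- Gibbs average of a two-replica observable `f(σ,τ)` where `σ, τ` are sampled from the
product of the Gibbs measures of the Hamiltonians `H₁`, `H₂`. -/
def gibbs2 (β : ℝ) (H₁ H₂ : (Fin N → Bool) → ℝ)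
    (f : (Fin N → Bool) → (Fin N → Bool) → ℝ) : ℝ :=
  (∑ σ : Fin N → Bool, ∑ τ : Fin N → Bool, f σ τ * Real.exp (β * H₁ σ + β * H₂ τ)) /
    ∑ σ : Fin N → Bool, ∑ τ : Fin N → Bool, Real.exp (β * H₁ σ + β * H₂ τ)

/-- Site overlap `R(σ,τ) = N⁻¹ Σ_i σ_i τ_i`. -/
def overlap (σ τ : Fin N → Bool) : ℝ := (∑ i, spin (σ i) * spin (τ i)) / N

/-- Fourier–Hermite coefficient `φ̂_{ij}(n) = E[⟨σ_i σ_j⟩ h_n(J)]` of the two-point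
correlation function. -/
def twoPointCoeff (Edges : Finset (Finset (Fin N))) (ρ : ℕ → ℝ → ℝ) (β : ℝ)
    (i j : Fin N) (n : Finset (Fin N) → ℕ) : ℝ :=
  ∫ ω, gibbs β (ham Edges ρ ω) (fun σ => spin (σ i) * spin (σ j)) * hermiteProd n ω
    ∂gaussianPi (Finset (Fin N))

/-- `E(n) = {e : n_e > 0}`. -/
def Esupp (n : Finset (Fin N) → ℕ) : Finset (Finset (Fin N)) :=
  Finset.univ.filter fun e => n e ≠ 0

/-- `V(n)`: the vertices covered by `E(n)`. -/
def Vsupp (n : Finset (Fin N) → ℕ) : Finset (Fin N) :=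
  (Esupp n).biUnion id

/-- Disorder-averaged two-replica observable under the continuous perturbation:
`E ⟨f(σ,τ)⟩_t` with `σ ~ G_J`, `τ ~ G_{J(t)}`. -/
def contExp (Edges : Finset (Finset (Fin N))) (ρ : ℕ → ℝ → ℝ) (β t : ℝ)
    (f : (Fin N → Bool) → (Fin N → Bool) → ℝ) : ℝ :=
  ∫ ω : (Finset (Fin N) → ℝ) × (Finset (Fin N) → ℝ),
    gibbs2 β (ham Edges ρ ω.1) (ham Edges ρ (contPerturb t ω.1 ω.2)) f
    ∂pairGauss (Finset (Fin N))

/-- Disorder-averaged two-replica observable under the discrete perturbation. -/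
def discExp (Edges : Finset (Finset (Fin N))) (ρ : ℕ → ℝ → ℝ) (β t : ℝ)
    (f : (Fin N → Bool) → (Fin N → Bool) → ℝ) : ℝ :=
  ∫ ω : (Finset (Fin N) → ℝ) × (Finset (Fin N) → ℝ) × (Finset (Fin N) → Bool),
    gibbs2 β (ham Edges ρ ω.1) (ham Edges ρ (discPerturb ω.1 ω.2.1 ω.2.2)) f
    ∂tripleGaussBer (Finset (Fin N)) (Real.exp (-t))

/-! ### Berge paths, distance, balls, cycles -/

/-- `(vs, es)` is a Berge path of length `ℓ` from `v` to `w` in the hypergraph `Edges`. -/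
def IsBergePath (Edges : Finset (Finset (Fin N))) (ℓ : ℕ)
    (vs : Fin (ℓ + 1) → Fin N) (es : Fin ℓ → Finset (Fin N)) (v w : Fin N) : Prop :=
  Function.Injective vs ∧ Function.Injective es ∧ (∀ k, es k ∈ Edges) ∧
    vs 0 = v ∧ vs (Fin.last ℓ) = w ∧
    ∀ k : Fin ℓ, vs k.castSucc ∈ es k ∧ vs k.succ ∈ es k

/-- Hypergraph (Berge) distance between two vertices, `∞` if there is no path. -/
def hdist (Edges : Finset (Finset (Fin N))) (v w : Fin N) : ℕ∞ :=
  sInf {d : ℕ∞ | ∃ (ℓ : ℕ) (vs : Fin (ℓ + 1) → Fin N) (es : Fin ℓ → Finset (Fin N)),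
    IsBergePath Edges ℓ vs es v w ∧ d = (ℓ : ℕ∞)}

open scoped Classical in
/-- The closed ball `B_r(v)` in the hypergraph distance. -/
def hball (Edges : Finset (Finset (Fin N))) (v : Fin N) (r : ℕ) : Finset (Fin N) :=
  Finset.univ.filter fun w => hdist Edges v w ≤ (r : ℕ∞)

/-- The hypergraph `Edges` contains a Berge cycle. -/
def HasBergeCycle (Edges : Finset (Finset (Fin N))) : Prop :=
  ∃ (ℓ : ℕ) (vs : Fin ℓ → Fin N) (es : Fin ℓ → Finset (Fin N)),
    2 ≤ ℓ ∧ Function.Injective vs ∧ Function.Injective es ∧ (∀ k, es k ∈ Edges) ∧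
      ∀ k : Fin ℓ, vs k ∈ es k ∧ vs (finRotate ℓ k) ∈ es k

/-- `min(d, c)` where `d ∈ ℕ∞` and `c ∈ ℝ` (equal to `c` if `d = ∞`). -/
def truncMin (d : ℕ∞) (c : ℝ) : ℝ :=
  if d = ⊤ then c else min (d.toNat : ℝ) c

/-! ### The diluted mixed p-spin random hypergraph -/

/-- Probability that a given hyperedge is present in the diluted model. -/
def edgeProb (α : ℕ → ℝ) (Δ N : ℕ) (e : Finset (Fin N)) : ℝ :=
  if 2 ≤ e.card ∧ e.card ≤ Δ then α e.card * N / (N.choose e.card) else 0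

/-- The law of the diluted mixed `p`-spin random hypergraph: each hyperedge `e` with
`2 ≤ |e| ≤ Δ` is present independently with probability `α_{|e|} N / C(N,|e|)`. -/
def graphMeasure (α : ℕ → ℝ) (Δ N : ℕ) : Measure (Finset (Fin N) → Bool) :=
  Measure.pi fun e => berBool (edgeProb α Δ N e)

/-- The (random) hyperedge set determined by the indicator `g`. -/
def edgesOf {N : ℕ} (Δ : ℕ) (g : Finset (Fin N) → Bool) : Finset (Finset (Fin N)) :=
  Finset.univ.filter fun e => g e = true ∧ 2 ≤ e.card ∧ e.card ≤ Δ

/-- `λ = Σ_p p(p-1) α_p`. -/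
def lamMix (α : ℕ → ℝ) (Δ : ℕ) : ℝ :=
  ∑ p ∈ Finset.Icc 2 Δ, (p : ℝ) * ((p : ℝ) - 1) * α p

/-- `λ' = Σ_p p(p-1)(p-2) α_p`. -/
def lamMix' (α : ℕ → ℝ) (Δ : ℕ) : ℝ :=
  ∑ p ∈ Finset.Icc 2 Δ, (p : ℝ) * ((p : ℝ) - 1) * ((p : ℝ) - 2) * α p

/-- The exploration (breadth-first search) process `(R_t, I_t, S_t, E_t)` of a hypergraph
started at the vertex `i`. -/
def explore {N : ℕ} (Edges : Finset (Finset (Fin N))) (i : Fin N) :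
    ℕ → Finset (Fin N) × Finset (Fin N) × Finset (Fin N) × Finset (Finset (Fin N))
  | 0 => (∅, {i}, Finset.univ.erase i, ∅)
  | t + 1 =>
      let P := explore Edges i t
      let Enew := Edges.filter fun e => (e ∩ P.2.1).Nonempty ∧ e ∩ P.1 = ∅
      (P.1 ∪ P.2.1, Enew.biUnion fun e => e ∩ P.2.2.1,
        P.2.2.1 \ Enew.biUnion fun e => e ∩ P.2.2.1, Enew)

/-- The set `I_t` of newly explored vertices at step `t`. -/
def Iset {N : ℕ} (Edges : Finset (Finset (Fin N))) (i : Fin N) (t : ℕ) : Finset (Fin N) :=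
  (explore Edges i t).2.1

/-- Disorder-and-graph-averaged two-replica observable under the continuous perturbation
in the diluted model. -/
def dilContExp (α : ℕ → ℝ) (Δ N : ℕ) (ρ : ℕ → ℝ → ℝ) (β t : ℝ)
    (f : (Fin N → Bool) → (Fin N → Bool) → ℝ) : ℝ :=
  ∫ ω : (Finset (Fin N) → Bool) × (Finset (Fin N) → ℝ) × (Finset (Fin N) → ℝ),
    gibbs2 β (ham (edgesOf Δ ω.1) ρ ω.2.1)
      (ham (edgesOf Δ ω.1) ρ (contPerturb t ω.2.1 ω.2.2)) f
    ∂((graphMeasure α Δ N).prod (pairGauss (Finset (Fin N))))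

/-- Disorder-and-graph-averaged two-replica observable under the discrete perturbation
in the diluted model. -/
def dilDiscExp (α : ℕ → ℝ) (Δ N : ℕ) (ρ : ℕ → ℝ → ℝ) (β t : ℝ)
    (f : (Fin N → Bool) → (Fin N → Bool) → ℝ) : ℝ :=
  ∫ ω : (Finset (Fin N) → Bool) ×
      (Finset (Fin N) → ℝ) × (Finset (Fin N) → ℝ) × (Finset (Fin N) → Bool),
    gibbs2 β (ham (edgesOf Δ ω.1) ρ ω.2.1)
      (ham (edgesOf Δ ω.1) ρ (discPerturb ω.2.1 ω.2.2.1 ω.2.2.2)) f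
    ∂((graphMeasure α Δ N).prod (tripleGaussBer (Finset (Fin N)) (Real.exp (-t))))

/-! ### The Lévy model -/

/-- Hamiltonian of the Lévy model: `H(σ) = a_N⁻¹ Σ_{i,j} ρ(J_{ij}) σ_i σ_j`. -/
def levyHam (N : ℕ) (aN : ℝ) (ρ : ℝ → ℝ) (J : Fin N × Fin N → ℝ) (σ : Fin N → Bool) : ℝ :=
  (∑ p : Fin N × Fin N, ρ (J p) * (spin (σ p.1) * spin (σ p.2))) / aN

/-- The normalization `a_N = inf{x > 0 : P(|ρ(J)| > x) ≤ 1/N}`. -/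
def levyAN (ρ : ℝ → ℝ) (N : ℕ) : ℝ :=
  sInf {x : ℝ | 0 < x ∧ ((gaussianReal 0 1) {j | x < |ρ j|}).toReal ≤ 1 / N}

/-- The coupled free energy `F_N(t,λ)` of the Lévy model, with the two systems
perturbed by the Ornstein–Uhlenbeck flow at time `t`. -/
def levyF (N : ℕ) (β aN lam : ℝ) (ρ : ℝ → ℝ) (t : ℝ) : ℝ :=
  (∫ ω : (Fin N × Fin N → ℝ) × (Fin N × Fin N → ℝ) × (Fin N × Fin N → ℝ),
      Real.log (∑ σ : Fin N → Bool, ∑ τ : Fin N → Bool,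
        Real.exp (β * levyHam N aN ρ (fun p => Real.exp (-t / 2) * ω.1 p +
              Real.sqrt (1 - Real.exp (-t)) * ω.2.1 p) σ +
          β * levyHam N aN ρ (fun p => Real.exp (-t / 2) * ω.1 p +
              Real.sqrt (1 - Real.exp (-t)) * ω.2.2 p) τ +
          lam * N * overlap σ τ ^ 2))
    ∂tripleGauss (Fin N × Fin N)) / N

/-- The coupled free energy `F_N(∞,λ)`: the two systems carry independent disorders. -/
def levyFinf (N : ℕ) (β aN lam : ℝ) (ρ : ℝ → ℝ) : ℝ :=
  (∫ ω : (Fin N × Fin N → ℝ) × (Fin N × Fin N → ℝ) × (Fin N × Fin N → ℝ),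
      Real.log (∑ σ : Fin N → Bool, ∑ τ : Fin N → Bool,
        Real.exp (β * levyHam N aN ρ ω.2.1 σ + β * levyHam N aN ρ ω.2.2 τ +
          lam * N * overlap σ τ ^ 2))
    ∂tripleGauss (Fin N × Fin N)) / N

/-- `φ(t) = Σ_r E[L_r(J¹(t)) L_r(J²(t))]` where `J^i(t) = e^{-t/2} J + √(1-e^{-t}) J^i`. -/
def phiFn (k m : ℕ) (L : Fin m → (Fin k → ℝ) → ℝ) (t : ℝ) : ℝ :=
  ∑ r : Fin m, ∫ ω : (Fin k → ℝ) × (Fin k → ℝ) × (Fin k → ℝ),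
    L r (fun l => Real.exp (-t / 2) * ω.1 l + Real.sqrt (1 - Real.exp (-t)) * ω.2.1 l) *
      L r (fun l => Real.exp (-t / 2) * ω.1 l + Real.sqrt (1 - Real.exp (-t)) * ω.2.2 l)
    ∂tripleGauss (Fin k)

open scoped ENNReal NNReal

theorem integral_abs_rpow_gaussianReal {q : ℝ} (hq : -1 < q) :
    ∫ x, |x| ^ q ∂gaussianReal 0 1
      = (√(2 * π))⁻¹ * (1 / 2 : ℝ) ^ (-(q + 1) / 2) * Real.Gamma ((q + 1) / 2) := by
  rw [integral_gaussianReal_eq_integral_smul one_ne_zero]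
  have h : ∀ x : ℝ, gaussianPDFReal 0 1 x • |x| ^ q
      = (fun y => (√(2 * π))⁻¹ * (y ^ q * exp (-(1 / 2) * y ^ (2 : ℝ)))) |x| := by
    intro x
    simp only [gaussianPDFReal, smul_eq_mul, NNReal.coe_one, mul_one, sub_zero, Real.rpow_two,
      sq_abs]
    rw [show -x ^ 2 / 2 = -(1 / 2) * x ^ 2 by ring]
    ring
  simp_rw [h]
  rw [integral_comp_abs (f := fun y => (√(2 * π))⁻¹ * (y ^ q * exp (-(1 / 2) * y ^ (2 : ℝ)))),
    integral_const_mul, integral_rpow_mul_exp_neg_mul_rpow two_pos hq (by norm_num)]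
  ring

theorem integral_abs_rpow_add_two_gaussianReal {q : ℝ} (hq : -1 < q) :
    ∫ x, |x| ^ (q + 2) ∂gaussianReal 0 1 = (q + 1) * ∫ x, |x| ^ q ∂gaussianReal 0 1 := by
  rw [integral_abs_rpow_gaussianReal hq, integral_abs_rpow_gaussianReal (by linarith),
    show (q + 2 + 1) / 2 = (q + 1) / 2 + 1 by ring, Real.Gamma_add_one (by linarith),
    show -(q + 2 + 1) / 2 = -(q + 1) / 2 - 1 by ring, Real.rpow_sub_one (by norm_num)]
  ring

theorem add_two_pow_le (k : ℕ) :
    (2 * (k : ℝ) + 4) ^ (k + 1) ≤ 3 * (2 * k + 4) * (2 * k + 2) ^ k := by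
  have h1 : (1 + 1 / ((k : ℝ) + 1)) ^ k ≤ 3 := by
    calc (1 + 1 / ((k : ℝ) + 1)) ^ k ≤ (exp (1 / ((k : ℝ) + 1))) ^ k := by
          gcongr
          linarith [Real.add_one_le_exp (1 / ((k : ℝ) + 1))]
      _ = exp (k * (1 / ((k : ℝ) + 1))) := by rw [← Real.exp_nat_mul]
      _ ≤ exp 1 := by
          gcongr
          rw [mul_one_div, div_le_one (by positivity)]
          linarith
      _ ≤ 3 := by linarith [Real.exp_one_lt_d9]
  have h2 : (2 * (k : ℝ) + 4) = (2 * k + 2) * (1 + 1 / ((k : ℝ) + 1)) := by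
    field_simp
    ring
  calc (2 * (k : ℝ) + 4) ^ (k + 1) = (2 * (k : ℝ) + 4) * (2 * k + 4) ^ k := by ring
    _ = (2 * (k : ℝ) + 4) * ((2 * k + 2) ^ k * (1 + 1 / ((k : ℝ) + 1)) ^ k) := by
        rw [← mul_pow, ← h2]
    _ ≤ (2 * (k : ℝ) + 4) * ((2 * k + 2) ^ k * 3) := by gcongr
    _ = _ := by ring

theorem pow_le_sq_integral_abs_gaussianReal (k : ℕ) :
    (2 * ((k : ℝ) + 1) + 2) ^ (k + 1)
      ≤ 4 ^ (k + 1) * (∫ x, |x| ^ (2 * ((k : ℝ) + 1)) ∂gaussianReal 0 1) ^ 2 := by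
  induction k with
  | zero =>
    have h := integral_abs_rpow_add_two_gaussianReal (q := 0) (by norm_num)
    simp only [Real.rpow_zero, integral_const, probReal_univ] at h
    norm_num at h
    norm_num [h]
  | succ k ih =>
    push_cast
    have h := integral_abs_rpow_add_two_gaussianReal (q := 2 * ((k : ℝ) + 1))
      (by have : (0 : ℝ) ≤ k := k.cast_nonneg; linarith)
    rw [show 2 * ((k : ℝ) + 1 + 1) = 2 * ((k : ℝ) + 1) + 2 by ring, h]
    set m := ∫ x, |x| ^ (2 * ((k : ℝ) + 1)) ∂gaussianReal 0 1
    have h3 := add_two_pow_le (k + 1)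
    push_cast at h3
    have hk : (0 : ℝ) ≤ k := k.cast_nonneg
    calc (2 * ((k : ℝ) + 1) + 2 + 2) ^ (k + 1 + 1)
        = (2 * ((k : ℝ) + 1) + 4) ^ (k + 1 + 1) := by ring
      _ ≤ _ := h3
      _ ≤ 3 * (2 * ((k : ℝ) + 1) + 4) * (4 ^ (k + 1) * m ^ 2) := by gcongr
      _ ≤ (4 * (2 * ((k : ℝ) + 1) + 1) ^ 2) * (4 ^ (k + 1) * m ^ 2) := by
        gcongr <;> nlinarith
      _ = _ := by ring

theorem integrable_abs_rpow_gaussianReal {q : ℝ} (hq : 0 < q) :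
    Integrable (fun x : ℝ => |x| ^ q) (gaussianReal 0 1) := by
  have h := (memLp_id_gaussianReal (μ := 0) (v := 1) (Real.toNNReal q)).integrable_norm_rpow
    (by simpa using hq) (by simp)
  simpa [Real.toNNReal_of_nonneg hq.le, hq.le] using h

/-- `q`-th absolute Gaussian norm satisfies `‖J‖_q² ≥ √q / 2`. -/
theorem sqrt_le_gaussian_norm {q : ℝ} (hq : 2 ≤ q) :
    √q ≤ 2 * (∫ x, |x| ^ q ∂gaussianReal 0 1) ^ (2 / q) := by
  obtain ⟨k, hk1, hk2⟩ : ∃ k : ℕ, 2 * ((k : ℝ) + 1) ≤ q ∧ q ≤ 2 * ((k : ℝ) + 1) + 2 := by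
    have h1 : 1 ≤ ⌊q / 2⌋₊ := Nat.one_le_floor_iff _ |>.2 (by linarith)
    refine ⟨⌊q / 2⌋₊ - 1, ?_, ?_⟩
    · have := Nat.floor_le (a := q / 2) (by linarith)
      push_cast [h1]
      linarith
    · have := Nat.lt_floor_add_one (q / 2)
      push_cast [h1]
      linarith
  set r : ℝ := 2 * ((k : ℝ) + 1) with hr
  have hr0 : 0 < r := by positivity
  set M := ∫ x, |x| ^ r ∂gaussianReal 0 1 with hM
  have hM0 : 0 ≤ M := integral_nonneg fun x => by positivity
  set Mq := ∫ x, |x| ^ q ∂gaussianReal 0 1 with hMq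
  have hMq0 : 0 ≤ Mq := integral_nonneg fun x => by positivity
  have hjensen : M ^ (q / r) ≤ Mq := by
    have hc := (convexOn_rpow (p := q / r) ((one_le_div hr0).2 hk1)).map_integral_le
      (μ := gaussianReal 0 1) (f := fun x : ℝ => |x| ^ r)
      (continuousOn_id.rpow_const fun x _ => Or.inr (by positivity)) isClosed_Ici
      (Filter.Eventually.of_forall fun x => by simp only [Set.mem_Ici]; positivity)
      (integrable_abs_rpow_gaussianReal hr0) ?_
    · refine hc.trans_eq (integral_congr_ae (Filter.Eventually.of_forall fun x => ?_))
      simp only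
      rw [← Real.rpow_mul (abs_nonneg x), mul_div_cancel₀ _ hr0.ne']
    · refine (integrable_abs_rpow_gaussianReal (by linarith : 0 < q)).congr
        (Filter.Eventually.of_forall fun x => ?_)
      simp only [Function.comp]
      rw [← Real.rpow_mul (abs_nonneg x), mul_div_cancel₀ _ hr0.ne']
  have h1 : M ^ (2 / r) ≤ Mq ^ (2 / q) := by
    calc M ^ (2 / r) = (M ^ (q / r)) ^ (2 / q) := by
          rw [← Real.rpow_mul hM0]
          congr 1
          field_simp
      _ ≤ Mq ^ (2 / q) := by gcongr
  have h2 := pow_le_sq_integral_abs_gaussianReal k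
  rw [← hr, ← hM] at h2
  have h3 : √q ≤ 2 * M ^ (2 / r) := by
    rw [Real.sqrt_le_left (by positivity)]
    have hpow : ((2 * M ^ (2 / r)) ^ 2) ^ (k + 1) = 4 ^ (k + 1) * M ^ 2 := by
      rw [mul_pow, mul_pow, ← Real.rpow_natCast (M ^ (2 / r)), ← Real.rpow_mul hM0,
        ← Real.rpow_natCast (M ^ (2 / r * _)), ← Real.rpow_mul hM0, ← Real.rpow_natCast M 2]
      congr 2
      · norm_num
      · rw [hr]; push_cast; field_simp
    refine hk2.trans (le_of_pow_le_pow_left₀ (n := k + 1) (by simp) (by positivity) ?_)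
    rw [hpow]
    exact h2
  linarith

theorem sinh_le_mul_cosh {x : ℝ} (hx : 0 ≤ x) : sinh x ≤ x * cosh x := by
  have hmono : MonotoneOn (fun x : ℝ => x * cosh x - sinh x) (Set.Ici 0) := by
    refine monotoneOn_of_deriv_nonneg (convex_Ici 0) (by fun_prop) (by fun_prop) fun y hy => ?_
    rw [interior_Ici] at hy
    have : HasDerivAt (fun x : ℝ => x * cosh x - sinh x)
        (1 * cosh y + y * sinh y - cosh y) y :=
      ((hasDerivAt_id y).mul (Real.hasDerivAt_cosh y)).sub (Real.hasDerivAt_sinh y)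
    rw [this.deriv]
    have h2 : 0 ≤ sinh y := Real.sinh_nonneg_iff.2 (le_of_lt hy)
    have := mul_nonneg (le_of_lt hy) h2
    linarith
  have := hmono (Set.mem_Ici.2 le_rfl) (Set.mem_Ici.2 hx) hx
  simp at this
  linarith

theorem cosh_mul_exp_neg_antitoneOn :
    AntitoneOn (fun x : ℝ => cosh x * exp (-x ^ 2 / 2)) (Set.Ici 0) := by
  refine antitoneOn_of_deriv_nonpos (convex_Ici 0) (by fun_prop) (by fun_prop) fun y hy => ?_
  rw [interior_Ici] at hy
  have h1 : HasDerivAt (fun x : ℝ => -x ^ 2 / 2) (-y) y := by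
    have := ((hasDerivAt_pow 2 y).neg).div_const 2
    convert! this using 1
    simp; ring
  have : HasDerivAt (fun x : ℝ => cosh x * exp (-x ^ 2 / 2))
      (sinh y * exp (-y ^ 2 / 2) + cosh y * (exp (-y ^ 2 / 2) * -y)) y :=
    (Real.hasDerivAt_cosh y).mul h1.exp
  rw [this.deriv]
  have h2 := sinh_le_mul_cosh (le_of_lt hy)
  nlinarith [exp_pos (-y ^ 2 / 2)]

theorem cosh_add_le {a b : ℝ} (ha : 0 ≤ a) (hb : 0 ≤ b) :
    cosh (a + b) ≤ exp (2 * (a * b)) * cosh (a - b) := by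
  have h := cosh_mul_exp_neg_antitoneOn (Set.mem_Ici.2 (abs_nonneg (a - b)))
    (Set.mem_Ici.2 (add_nonneg ha hb)) (abs_le.2 ⟨by linarith, by linarith⟩)
  simp only [cosh_abs, sq_abs] at h
  have h2 : exp (-(a - b) ^ 2 / 2) = exp (2 * (a * b)) * exp (-(a + b) ^ 2 / 2) := by
    rw [← exp_add]; congr 1; ring
  rw [h2] at h
  have := exp_pos (-(a + b) ^ 2 / 2)
  nlinarith

theorem one_add_cosh_add_le {d e : ℝ} (hd : 0 ≤ d) (he : 0 ≤ e) :
    1 + cosh (d + e) ≤ exp (d * e) * (1 + cosh (d - e)) := by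
  have h := cosh_add_le (a := d / 2) (b := e / 2) (by linarith) (by linarith)
  have h1 : ∀ x : ℝ, 1 + cosh x = 2 * cosh (x / 2) ^ 2 := by
    intro x
    have := Real.cosh_two_mul (x / 2)
    have h2 := Real.cosh_sq (x / 2)
    rw [show 2 * (x / 2) = x by ring] at this
    linarith
  rw [h1, h1, show (d + e) / 2 = d / 2 + e / 2 by ring, show (d - e) / 2 = d / 2 - e / 2 by ring]
  have h2 : exp (d * e) = exp (2 * (d / 2 * (e / 2))) ^ 2 := by
    rw [← exp_nat_mul]; congr 1; push_cast; ring
  rw [h2]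
  have h3 : 0 ≤ cosh (d / 2 + e / 2) := (cosh_pos _).le
  nlinarith [mul_self_le_mul_self h3 h]

/-- Mixed second difference of a four-term log-partition function, in exponentiated form. -/
theorem four_term_mixed_difference {P Q R S d e : ℝ} (hP : 0 ≤ P) (hQ : 0 ≤ Q) (hR : 0 ≤ R)
    (hS : 0 ≤ S) (hd : 0 ≤ d) (he : 0 ≤ e) :
    (P + Q + R + S) *
        (P * (exp d * exp e) + Q * (exp d * exp (-e)) + R * (exp (-d) * exp e)
          + S * (exp (-d) * exp (-e)))
      ≤ exp (d * e) * ((P * exp e + Q * exp (-e) + R * exp e + S * exp (-e)) *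
        (P * exp d + Q * exp d + R * exp (-d) + S * exp (-d))) := by
  have h0 := one_add_cosh_add_le hd he
  rw [cosh_eq, cosh_eq, neg_add, neg_sub', exp_add, exp_add, sub_eq_add_neg, exp_add,
    sub_neg_eq_add, exp_add] at h0
  have hK : 1 ≤ exp (d * e) := one_le_exp (mul_nonneg hd he)
  have hd1 : exp d * exp (-d) = 1 := by rw [← exp_add]; simp
  have he1 : exp e * exp (-e) = 1 := by rw [← exp_add]; simp
  have hD1 : 1 ≤ exp d := one_le_exp hd
  have hE1 : 1 ≤ exp e := one_le_exp he
  have hd' : exp (-d) ≤ 1 := exp_le_one_iff.2 (by linarith)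
  have he' : exp (-e) ≤ 1 := exp_le_one_iff.2 (by linarith)
  have p1 := exp_pos (-d)
  have p2 := exp_pos (-e)
  generalize exp (d * e) = K at *
  generalize exp d = D at *
  generalize exp (-d) = D' at *
  generalize exp e = E at *
  generalize exp (-e) = E' at *
  have hPS : P * S * (D * E + D' * E' - K * (D * E' + D' * E))
      ≤ (K - 1) * (P ^ 2 * (D * E) + S ^ 2 * (D' * E')) := by
    have a1 : D * E + D' * E' - K * (D * E' + D' * E) ≤ 2 * (K - 1) := by linarith
    have a2 : 2 * (P * S) ≤ P ^ 2 * (D * E) + S ^ 2 * (D' * E') := by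
      have : (D * E) * (D' * E') = 1 := by
        calc _ = (D * D') * (E * E') := by ring
          _ = 1 := by rw [hd1, he1, one_mul]
      have hDE : 0 < D * E := by positivity
      have h3 : D' * E' = 1 / (D * E) := by field_simp; linarith
      rw [h3]
      have : P ^ 2 * (D * E) + S ^ 2 * (1 / (D * E)) - 2 * (P * S)
          = (P * (D * E) - S) ^ 2 / (D * E) := by field_simp; ring
      have : 0 ≤ (P * (D * E) - S) ^ 2 / (D * E) := by positivity
      linarith
    calc _ ≤ P * S * (2 * (K - 1)) := by gcongr
      _ = (K - 1) * (2 * (P * S)) := by ring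
      _ ≤ _ := by
        have : 0 ≤ K - 1 := by linarith
        gcongr
  have hQR : 0 ≤ Q * R * (K * (D * E + D' * E') - (D * E' + D' * E)) := by
    have : 0 ≤ (D - D') * (E - E') := mul_nonneg (by linarith) (by linarith)
    have h2 : 0 ≤ (K - 1) * (D * E + D' * E') :=
      mul_nonneg (by linarith) (by positivity)
    have : 0 ≤ K * (D * E + D' * E') - (D * E' + D' * E) := by nlinarith
    positivity
  have hK0 : 0 ≤ K - 1 := by linarith
  have hrest : 0 ≤ (K - 1) * (Q ^ 2 * (D * E') + R ^ 2 * (D' * E) + P * Q * (D * E + D * E')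
      + P * R * (D * E + D' * E) + Q * S * (D * E' + D' * E') + R * S * (D' * E + D' * E')) := by
    positivity
  nlinarith

theorem lintegral_exp_neg_mul_sub_sq {A : ℝ} (hA : 0 < A) (m : ℝ) :
    ∫⁻ x, ENNReal.ofReal (exp (-(A / 2) * (x - m) ^ 2)) = ENNReal.ofReal √(2 * π / A) := by
  rw [lintegral_sub_right_eq_self (fun x => ENNReal.ofReal (exp (-(A / 2) * x ^ 2))) m,
    ← ofReal_integral_eq_lintegral_ofReal (integrable_exp_neg_mul_sq (by positivity))
      (Filter.Eventually.of_forall fun x => (exp_pos _).le), integral_gaussian]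
  congr 2
  field_simp

theorem lintegral_gaussianReal_eq {f : ℝ → ℝ≥0∞} (m : ℝ) {v : ℝ≥0} (hv : v ≠ 0) :
    ∫⁻ x, f x ∂gaussianReal m v = ∫⁻ x, gaussianPDF m v x * f x := by
  rw [gaussianReal_of_var_ne_zero m hv,
    lintegral_withDensity_eq_lintegral_mul_non_measurable _ (measurable_gaussianPDF m v)
      (Filter.Eventually.of_forall fun x => gaussianPDF_lt_top)]
  rfl

/-- The integral of the exponential of a quadratic polynomial, given in the form
`-x²/2 + h x = -(A/2)(x-m)² + e`, against the standard Gaussian measure. -/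
theorem lintegral_gaussianReal_exp {A : ℝ} (hA : 0 < A) (m e : ℝ) {h : ℝ → ℝ}
    (hh : ∀ x, -x ^ 2 / 2 + h x = -(A / 2) * (x - m) ^ 2 + e) :
    ∫⁻ x, ENNReal.ofReal (exp (h x)) ∂gaussianReal 0 1
      = ENNReal.ofReal ((√A)⁻¹ * exp e) := by
  rw [lintegral_gaussianReal_eq 0 one_ne_zero]
  have h1 : ∀ x, gaussianPDF 0 1 x * ENNReal.ofReal (exp (h x))
      = ENNReal.ofReal ((√(2 * π))⁻¹ * exp e) *
        ENNReal.ofReal (exp (-(A / 2) * (x - m) ^ 2)) := by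
    intro x
    rw [gaussianPDF, ← ENNReal.ofReal_mul (gaussianPDFReal_nonneg _ _ _),
      ← ENNReal.ofReal_mul (by positivity)]
    congr 1
    simp only [gaussianPDFReal, NNReal.coe_one, mul_one, sub_zero]
    rw [mul_assoc, mul_assoc, ← exp_add, ← exp_add, hh x, add_comm]
  simp_rw [h1]
  rw [lintegral_const_mul' _ _ ENNReal.ofReal_ne_top, lintegral_exp_neg_mul_sub_sq hA,
    ← ENNReal.ofReal_mul (by positivity)]
  congr 1
  rw [Real.sqrt_div (by positivity)]
  field_simp

/-- Density of the law of `c z + d J` with respect to the standard Gaussian measure. -/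
def mehlerKernel (c d z x : ℝ) : ℝ := d⁻¹ * exp (x ^ 2 / 2 - (x - c * z) ^ 2 / (2 * d ^ 2))

theorem lintegral_ou_eq {c d : ℝ} (hd : 0 < d) {f : ℝ → ℝ≥0∞} (hf : Measurable f) (z : ℝ) :
    ∫⁻ j, f (c * z + d * j) ∂gaussianReal 0 1
      = ∫⁻ x, f x * ENNReal.ofReal (mehlerKernel c d z x) ∂gaussianReal 0 1 := by
  have hmap : (gaussianReal 0 1).map (fun j => c * z + d * j)
      = gaussianReal (c * z) (Real.toNNReal (d ^ 2)) := by
    have : (fun j => c * z + d * j) = (fun x => c * z + x) ∘ (fun j => d * j) := rfl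
    rw [this, ← Measure.map_map (by fun_prop) (by fun_prop), gaussianReal_map_const_mul,
      gaussianReal_map_const_add]
    congr 1
    · ring
    · ext; simp [Real.toNNReal_of_nonneg (sq_nonneg d)]
  have hv : Real.toNNReal (d ^ 2) ≠ 0 := by
    simpa using hd.ne'
  rw [← lintegral_map hf (by fun_prop), hmap, lintegral_gaussianReal_eq _ hv,
    lintegral_gaussianReal_eq _ one_ne_zero]
  refine lintegral_congr fun x => ?_
  rw [mul_comm (f x), ← mul_assoc]
  congr 1
  rw [gaussianPDF, gaussianPDF, ← ENNReal.ofReal_mul (gaussianPDFReal_nonneg _ _ _)]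
  congr 1
  simp only [gaussianPDFReal, mehlerKernel, NNReal.coe_one, mul_one, sub_zero,
    Real.coe_toNNReal _ (sq_nonneg d)]
  rw [Real.sqrt_mul (by positivity), Real.sqrt_sq hd.le, mul_inv, mul_assoc, mul_assoc,
    mul_left_comm (exp _), ← exp_add]
  congr 3
  ring

theorem lintegral_mehlerKernel_rpow {c d r : ℝ} (hcd : c ^ 2 + d ^ 2 = 1) (hd : 0 < d)
    (hr : 0 < r) (z : ℝ) :
    ∫⁻ x, ENNReal.ofReal (mehlerKernel c d z x) ^ r ∂gaussianReal 0 1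
      = ENNReal.ofReal (d⁻¹ ^ r * (√(1 + r * c ^ 2 / d ^ 2))⁻¹ *
          exp (r * (c ^ 2 * (r - 1) / (d ^ 2 + r * c ^ 2)) * z ^ 2 / 2)) := by
  have hA : 0 < 1 + r * c ^ 2 / d ^ 2 := by positivity
  have h1 : ∀ x, ENNReal.ofReal (mehlerKernel c d z x) ^ r
      = ENNReal.ofReal (d⁻¹ ^ r) *
        ENNReal.ofReal (exp (r * (x ^ 2 / 2 - (x - c * z) ^ 2 / (2 * d ^ 2)))) := by
    intro x
    rw [mehlerKernel, ENNReal.ofReal_rpow_of_pos (by positivity),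
      Real.mul_rpow (by positivity) (exp_pos _).le, ENNReal.ofReal_mul (by positivity),
      ← Real.exp_mul, mul_comm _ r]
  simp_rw [h1]
  rw [lintegral_const_mul' _ _ ENNReal.ofReal_ne_top,
    lintegral_gaussianReal_exp hA (r * c * z / (d ^ 2 + r * c ^ 2))
      (r * (c ^ 2 * (r - 1) / (d ^ 2 + r * c ^ 2)) * z ^ 2 / 2) ?_,
    ← ENNReal.ofReal_mul (by positivity), mul_assoc (d⁻¹ ^ r)]
  intro x
  have hD : d ^ 2 + r * c ^ 2 ≠ 0 := by positivity
  have hc : r - 1 = (r - d ^ 2 - r * c ^ 2) / d ^ 2 := by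
    field_simp
    linear_combination r * hcd
  rw [hc]
  field_simp
  linear_combination x ^ 2 * (d ^ 2 * r + r ^ 2 * c ^ 2) * hcd

theorem lintegral_exp_sq_gaussianReal {κ : ℝ} (hκ : 2 * κ < 1) :
    ∫⁻ z, ENNReal.ofReal (exp (κ * z ^ 2)) ∂gaussianReal 0 1
      = ENNReal.ofReal (√(1 - 2 * κ))⁻¹ := by
  rw [lintegral_gaussianReal_exp (A := 1 - 2 * κ) (by linarith) 0 0 (fun x => by ring)]
  simp

/-- A non-sharp hypercontractive estimate for the Ornstein–Uhlenbeck semigroup. -/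
theorem lintegral_ou_sq_le {c d p : ℝ} (hcd : c ^ 2 + d ^ 2 = 1) (hd : 0 < d)
    (hp : 1 + c ^ 2 < p) {f : ℝ → ℝ≥0∞} (hf : Measurable f) :
    ∫⁻ z, (∫⁻ j, f (c * z + d * j) ∂gaussianReal 0 1) ^ 2 ∂gaussianReal 0 1
      ≤ (∫⁻ x, f x ^ p ∂gaussianReal 0 1) ^ (2 / p) *
        ENNReal.ofReal ((d ^ 2)⁻¹ * √((p - 1 + c ^ 2) / (p - 1 - c ^ 2))) := by
  have hp1 : 1 < p := by nlinarith [sq_nonneg c]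
  obtain ⟨r, hr⟩ : ∃ r, p.HolderConjugate r := ⟨_, Real.HolderConjugate.conjExponent hp1⟩
  have hr0 : 0 < r := hr.symm.pos
  have hr1 : r = p / (p - 1) := hr.conjugate_eq
  set κ := c ^ 2 * (r - 1) / (d ^ 2 + r * c ^ 2) with hκ
  have hκ' : κ = c ^ 2 / (p - 1 + c ^ 2) := by
    have h1 : p - 1 ≠ 0 := by linarith
    have h2 : p - 1 + c ^ 2 ≠ 0 := by nlinarith [sq_nonneg c]
    have h3 : r - 1 = 1 / (p - 1) := by rw [hr1]; field_simp; ring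
    have h4 : d ^ 2 + r * c ^ 2 = (p - 1 + c ^ 2) / (p - 1) := by
      have : d ^ 2 = 1 - c ^ 2 := by linarith
      rw [hr1, this]; field_simp; ring
    rw [hκ, h3, h4]
    field_simp
  have hden : 0 < p - 1 + c ^ 2 := by nlinarith [sq_nonneg c]
  have hκ1 : 1 - 2 * κ = (p - 1 - c ^ 2) / (p - 1 + c ^ 2) := by
    rw [hκ']; field_simp; ring
  have hκ2 : 2 * κ < 1 := by
    have : 0 < (p - 1 - c ^ 2) / (p - 1 + c ^ 2) := div_pos (by linarith) hden
    linarith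
  set F := ∫⁻ x, f x ^ p ∂gaussianReal 0 1
  have hpt : ∀ z, (∫⁻ j, f (c * z + d * j) ∂gaussianReal 0 1) ^ 2
      ≤ F ^ (2 / p) * (ENNReal.ofReal (d ^ 2)⁻¹ * ENNReal.ofReal (exp (κ * z ^ 2))) := by
    intro z
    have hk : Measurable fun x => ENNReal.ofReal (mehlerKernel c d z x) := by
      unfold mehlerKernel; fun_prop
    have hhold := ENNReal.lintegral_mul_le_Lp_mul_Lq (gaussianReal 0 1) hr hf.aemeasurable
      hk.aemeasurable
    simp only [Pi.mul_apply] at hhold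
    rw [← lintegral_ou_eq hd hf, lintegral_mehlerKernel_rpow hcd hd hr0] at hhold
    refine (pow_le_pow_left' hhold 2).trans ?_
    rw [mul_pow]
    have e1 : (F ^ (1 / p)) ^ 2 = F ^ (2 / p) := by
      rw [← ENNReal.rpow_natCast, ← ENNReal.rpow_mul]; congr 1; push_cast; ring
    rw [e1]
    gcongr
    rw [← ENNReal.ofReal_mul (by positivity), ENNReal.ofReal_rpow_of_nonneg (by positivity)
      (by positivity), ← ENNReal.ofReal_pow (by positivity)]
    refine ENNReal.ofReal_le_ofReal ?_
    have hA : (√(1 + r * c ^ 2 / d ^ 2))⁻¹ ≤ 1 := by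
      refine inv_le_one_of_one_le₀ (Real.one_le_sqrt.2 ?_)
      have : 0 ≤ r * c ^ 2 / d ^ 2 := by positivity
      linarith
    calc ((d⁻¹ ^ r * (√(1 + r * c ^ 2 / d ^ 2))⁻¹ * exp (r * κ * z ^ 2 / 2)) ^ (1 / r)) ^ 2
        ≤ ((d⁻¹ ^ r * 1 * exp (r * κ * z ^ 2 / 2)) ^ (1 / r)) ^ 2 := by gcongr
      _ = (d ^ 2)⁻¹ * exp (κ * z ^ 2) := by
        rw [mul_one, Real.mul_rpow (by positivity) (by positivity), mul_pow,
          ← Real.rpow_mul (by positivity), mul_one_div_cancel hr0.ne', Real.rpow_one, inv_pow,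
          ← Real.exp_mul, ← Real.exp_nat_mul]
        congr 2
        push_cast
        field_simp
  refine (lintegral_mono hpt).trans_eq ?_
  rw [lintegral_const_mul _ (by fun_prop), lintegral_const_mul _ (by fun_prop),
    lintegral_exp_sq_gaussianReal hκ2, ← ENNReal.ofReal_mul (by positivity), hκ1,
    ← Real.sqrt_inv, inv_div]

theorem integrable_abs_rpow_of_geometric_tail {Ω : Type*} [MeasurableSpace Ω] {μ : Measure Ω}
    [IsProbabilityMeasure μ] {f : Ω → ℝ} (hf : Measurable f) {p p' x₀ : ℝ} (hp : 0 < p)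
    (hpp : p < p') (hx₀ : 0 < x₀)
    (h : ∀ n : ℕ, μ.real {ω | 2 ^ n * x₀ < |f ω|} ≤ ((2 : ℝ) ^ (-p')) ^ n) :
    Integrable (fun ω => |f ω| ^ p) μ := by
  refine ⟨(hf.abs.pow_const p).aestronglyMeasurable, ?_⟩
  have hnn : ∀ ω, 0 ≤ |f ω| ^ p := fun ω => by positivity
  rw [hasFiniteIntegral_iff_ofReal (Filter.Eventually.of_forall hnn)]
  have hpt : ∀ ω, ENNReal.ofReal (|f ω| ^ p) ≤ ENNReal.ofReal (x₀ ^ p) +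
      ∑' n : ℕ, Set.indicator {ω | 2 ^ n * x₀ < |f ω|}
        (fun _ => ENNReal.ofReal ((2 ^ (n + 1) * x₀) ^ p)) ω := by
    intro ω
    rcases le_or_gt |f ω| x₀ with hle | hlt
    · refine le_add_right (ENNReal.ofReal_le_ofReal ?_)
      gcongr
    · obtain ⟨n, hn1, hn2⟩ : ∃ n : ℕ, 2 ^ n * x₀ < |f ω| ∧ |f ω| ≤ 2 ^ (n + 1) * x₀ := by
        have hex : ∃ n : ℕ, |f ω| ≤ 2 ^ n * x₀ := by
          obtain ⟨n, hn⟩ := pow_unbounded_of_one_lt (|f ω| / x₀) one_lt_two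
          exact ⟨n, ((div_lt_iff₀ hx₀).1 hn).le⟩
        obtain ⟨m, hm⟩ : ∃ m, Nat.find hex = m + 1 :=
          Nat.exists_eq_succ_of_ne_zero fun h0 => by
            have := Nat.find_spec hex
            rw [h0, pow_zero, one_mul] at this
            exact this.not_gt hlt
        exact ⟨m, not_le.1 (Nat.find_min hex (by omega)), hm ▸ Nat.find_spec hex⟩
      refine le_add_left ?_
      refine le_trans ?_ (ENNReal.le_tsum n)
      rw [Set.indicator_of_mem (by exact hn1)]
      refine ENNReal.ofReal_le_ofReal ?_
      gcongr
  refine (lintegral_mono hpt).trans_lt ?_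
  have hms : ∀ n : ℕ, MeasurableSet {ω | 2 ^ n * x₀ < |f ω|} := fun n =>
    measurableSet_lt measurable_const (by fun_prop)
  rw [lintegral_add_left measurable_const,
    lintegral_tsum fun n => (measurable_const.indicator (hms n)).aemeasurable]
  simp_rw [lintegral_indicator_const (hms _)]
  rw [lintegral_const, measure_univ, mul_one]
  refine ENNReal.add_lt_top.2 ⟨ENNReal.ofReal_lt_top, ?_⟩
  have hr : (2 : ℝ) ^ (p - p') < 1 := Real.rpow_lt_one_of_one_lt_of_neg one_lt_two (by linarith)
  have hr0 : (0 : ℝ) < (2 : ℝ) ^ (p - p') := by positivity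
  have hterm : ∀ n : ℕ, ENNReal.ofReal ((2 ^ (n + 1) * x₀) ^ p) * μ {ω | 2 ^ n * x₀ < |f ω|}
      ≤ ENNReal.ofReal ((2 * x₀) ^ p * ((2 : ℝ) ^ (p - p')) ^ n) := by
    intro n
    rw [← ofReal_measureReal, ← ENNReal.ofReal_mul (by positivity)]
    refine ENNReal.ofReal_le_ofReal ((mul_le_mul_of_nonneg_left (h n) (by positivity)).trans_eq ?_)
    rw [pow_succ, mul_assoc, Real.mul_rpow (by positivity) (by positivity), sub_eq_add_neg,
      Real.rpow_add two_pos, mul_pow, ← Real.rpow_natCast, ← Real.rpow_natCast ((2:ℝ) ^ p),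
      ← Real.rpow_mul zero_le_two, ← Real.rpow_mul zero_le_two, mul_comm (n : ℝ) p]
    ring
  refine (ENNReal.tsum_le_tsum hterm).trans_lt ?_
  rw [← ENNReal.ofReal_tsum_of_nonneg (fun n => by positivity)
    ((summable_geometric_of_lt_one hr0.le hr).mul_left _)]
  exact ENNReal.ofReal_lt_top

theorem integrable_abs_rpow_of_regularly_varying_tail {Ω : Type*} [MeasurableSpace Ω]
    {μ : Measure Ω} [IsProbabilityMeasure μ] {f : Ω → ℝ} (hf : Measurable f) {L : ℝ → ℝ} {α p : ℝ}
    (hL : ∀ x > 0, 0 < L x)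
    (hslow : Filter.Tendsto (fun x => L (2 * x) / L x) Filter.atTop (nhds 1))
    (htail : ∀ x > 0, μ.real {ω | x < |f ω|} = L x / x ^ α) (hp : 0 < p) (hpα : p < α) :
    Integrable (fun ω => |f ω| ^ p) μ := by
  obtain ⟨p', hp1, hp2⟩ := exists_between hpα
  have h1 : 1 < (2 : ℝ) ^ (α - p') := Real.one_lt_rpow one_lt_two (by linarith)
  obtain ⟨x₁, hx₁⟩ := Filter.eventually_atTop.1 (hslow.eventually (gt_mem_nhds h1))
  set x₀ := max x₁ 1
  have hx₀ : 0 < x₀ := lt_max_of_lt_right one_pos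
  refine integrable_abs_rpow_of_geometric_tail hf hp hp1 hx₀ fun n => ?_
  induction n with
  | zero => simp
  | succ n ih =>
    have hy : 0 < 2 ^ n * x₀ := by positivity
    have hyx : x₁ ≤ 2 ^ n * x₀ := (le_max_left _ _).trans
      (le_mul_of_one_le_left hx₀.le (one_le_pow₀ one_le_two))
    have h2 := (hx₁ _ hyx).le
    rw [div_le_iff₀ (hL _ hy)] at h2
    rw [htail _ hy] at ih
    rw [pow_succ', mul_assoc, htail _ (by positivity), Real.mul_rpow zero_le_two hy.le, pow_succ']
    calc L (2 * (2 ^ n * x₀)) / (2 ^ α * (2 ^ n * x₀) ^ α)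
        ≤ (2 ^ (α - p') * L (2 ^ n * x₀)) / (2 ^ α * (2 ^ n * x₀) ^ α) := by gcongr
      _ = 2 ^ (-p') * (L (2 ^ n * x₀) / (2 ^ n * x₀) ^ α) := by
        rw [sub_eq_add_neg, Real.rpow_add two_pos]
        field_simp
      _ ≤ _ := by gcongr

theorem sum_exp_mixed_difference {κ : Type*} [Fintype κ] {w a b : κ → ℝ} (hw : ∀ k, 0 ≤ w k)
    (ha : ∀ k, a k = 1 ∨ a k = -1) (hb : ∀ k, b k = 1 ∨ b k = -1) {d e : ℝ} (hd : 0 ≤ d)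
    (he : 0 ≤ e) :
    (∑ k, w k) * (∑ k, w k * (exp (d * a k) * exp (e * b k)))
      ≤ exp (d * e) * ((∑ k, w k * exp (e * b k)) * (∑ k, w k * exp (d * a k))) := by
  have key : ∀ F : ℝ → ℝ → ℝ, ∑ k, w k * F (a k) (b k)
      = (∑ k, w k * ((1 + a k) / 2 * ((1 + b k) / 2))) * F 1 1
        + (∑ k, w k * ((1 + a k) / 2 * ((1 - b k) / 2))) * F 1 (-1)
        + (∑ k, w k * ((1 - a k) / 2 * ((1 + b k) / 2))) * F (-1) 1
        + (∑ k, w k * ((1 - a k) / 2 * ((1 - b k) / 2))) * F (-1) (-1) := by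
    intro F
    simp only [Finset.sum_mul, ← Finset.sum_add_distrib]
    refine Finset.sum_congr rfl fun k _ => ?_
    rcases ha k with h | h <;> rcases hb k with h' | h' <;> rw [h, h'] <;> ring
  have hnn : ∀ s t : ℝ, (s = 1 ∨ s = -1) → (t = 1 ∨ t = -1) →
      0 ≤ ∑ k, w k * ((1 + s * a k) / 2 * ((1 + t * b k) / 2)) := by
    intro s t hs ht
    refine Finset.sum_nonneg fun k _ => mul_nonneg (hw k) (mul_nonneg ?_ ?_)
    · rcases ha k with h | h <;> rcases hs with h' | h' <;> rw [h, h'] <;> norm_num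
    · rcases hb k with h | h <;> rcases ht with h' | h' <;> rw [h, h'] <;> norm_num
  have h1 := hnn 1 1 (.inl rfl) (.inl rfl)
  have h2 := hnn 1 (-1) (.inl rfl) (.inr rfl)
  have h3 := hnn (-1) 1 (.inr rfl) (.inl rfl)
  have h4 := hnn (-1) (-1) (.inr rfl) (.inr rfl)
  simp only [one_mul, neg_one_mul, ← sub_eq_add_neg] at h1 h2 h3 h4
  have h := four_term_mixed_difference h1 h2 h3 h4 hd he
  have e0 := key fun _ _ => 1
  have e1 := key fun x y => exp (d * x) * exp (e * y)
  have e2 := key fun _ y => exp (e * y)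
  have e3 := key fun x _ => exp (d * x)
  simp only [mul_one, mul_neg_one] at e0 e1 e2 e3
  rw [e0, e1, e2, e3]
  exact h

theorem log_sum_exp_mixed_difference {κ : Type*} [Fintype κ] [Nonempty κ] (A : κ → ℝ)
    {a b : κ → ℝ} (ha : ∀ k, a k = 1 ∨ a k = -1) (hb : ∀ k, b k = 1 ∨ b k = -1) {c : ℝ}
    (hc : 0 ≤ c) {u u' v v' : ℝ} (h : 0 ≤ (u' - u) * (v' - v)) :
    log (∑ k, exp (A k + c * (u * a k) + c * (v * b k)))
        + log (∑ k, exp (A k + c * (u' * a k) + c * (v' * b k)))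
        - log (∑ k, exp (A k + c * (u * a k) + c * (v' * b k)))
        - log (∑ k, exp (A k + c * (u' * a k) + c * (v * b k)))
      ≤ c ^ 2 * ((u' - u) * (v' - v)) := by
  wlog hu : u < u' generalizing u u' v v'
  · rcases (not_lt.1 hu).lt_or_eq with hlt | rfl
    · have := @this u' u v' v (by linarith) hlt
      linarith
    · simp only [sub_self, zero_mul, mul_zero]
      linarith
  have hv : 0 ≤ v' - v := nonneg_of_mul_nonneg_right h (by linarith)
  have hpos : ∀ f : κ → ℝ, 0 < ∑ k, exp (f k) := fun f =>
    Finset.sum_pos (fun k _ => exp_pos _) Finset.univ_nonempty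
  have := sum_exp_mixed_difference
    (w := fun k => exp (A k + c * (u * a k) + c * (v * b k))) (fun k => (exp_pos _).le) ha hb
    (d := c * (u' - u)) (e := c * (v' - v)) (mul_nonneg hc (by linarith)) (mul_nonneg hc hv)
  simp only [← exp_add] at this
  have e1 : ∀ k, A k + c * (u * a k) + c * (v * b k)
      + (c * (u' - u) * a k + c * (v' - v) * b k)
      = A k + c * (u' * a k) + c * (v' * b k) := fun k => by ring
  have e2 : ∀ k, A k + c * (u * a k) + c * (v * b k) + c * (v' - v) * b k
      = A k + c * (u * a k) + c * (v' * b k) := fun k => by ring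
  have e3 : ∀ k, A k + c * (u * a k) + c * (v * b k) + c * (u' - u) * a k
      = A k + c * (u' * a k) + c * (v * b k) := fun k => by ring
  simp only [e1, e2, e3] at this
  have h2 := log_le_log (mul_pos (hpos _) (hpos _)) this
  rw [log_mul (hpos _).ne' (hpos _).ne', log_mul (exp_pos _).ne' (mul_pos (hpos _) (hpos _)).ne',
    log_mul (hpos _).ne' (hpos _).ne', log_exp] at h2
  linarith

/-- Log-partition function of two coupled systems with couplings `x` and `y`. -/
def coupledLogSum {ι κ : Type*} [Fintype ι] [Fintype κ] (c : ℝ) (B : κ → ℝ) (a b : κ → ι → ℝ)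
    (x y : ι → ℝ) : ℝ :=
  log (∑ k, exp (B k + c * (∑ q, x q * a k q) + c * (∑ q, y q * b k q)))

theorem coupledLogSum_mixed_difference {ι κ : Type*} [Fintype ι] [DecidableEq ι] [Fintype κ]
    [Nonempty κ] (B : κ → ℝ) {a b : κ → ι → ℝ} (ha : ∀ k q, a k q = 1 ∨ a k q = -1)
    (hb : ∀ k q, b k q = 1 ∨ b k q = -1) {c : ℝ} (hc : 0 ≤ c) (x y : ι → ℝ) (p : ι) {u v : ℝ}
    (h : 0 ≤ (u - x p) * (v - y p)) :
    coupledLogSum c B a b x y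
        + coupledLogSum c B a b (Function.update x p u) (Function.update y p v)
        - coupledLogSum c B a b x (Function.update y p v)
        - coupledLogSum c B a b (Function.update x p u) y
      ≤ c ^ 2 * ((u - x p) * (v - y p)) := by
  have hsplit : ∀ (z : ι → ℝ) (s : ℝ) (α : ι → ℝ), ∑ q, Function.update z p s q * α q
      = ∑ q ∈ univ.erase p, z q * α q + s * α p := by
    intro z s α
    rw [← Finset.sum_erase_add _ _ (Finset.mem_univ p), Function.update_self]
    congr 1
    refine Finset.sum_congr rfl fun q hq => ?_
    rw [Function.update_of_ne (Finset.ne_of_mem_erase hq)]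
  have hform : ∀ s t : ℝ, coupledLogSum c B a b (Function.update x p s) (Function.update y p t)
      = log (∑ k, exp ((B k + c * (∑ q ∈ univ.erase p, x q * a k q)
        + c * (∑ q ∈ univ.erase p, y q * b k q)) + c * (s * a k p) + c * (t * b k p))) := by
    intro s t
    simp only [coupledLogSum, hsplit]
    congr 1
    refine Finset.sum_congr rfl fun k _ => ?_
    congr 1
    ring
  have h1 := hform (x p) (y p)
  have h2 := hform u v
  have h3 := hform (x p) v
  have h4 := hform u (y p)
  rw [Function.update_eq_self] at h1 h3
  rw [Function.update_eq_self] at h1 h4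
  rw [h1, h2, h3, h4]
  exact log_sum_exp_mixed_difference _ (fun k => ha k p) (fun k => hb k p) hc h

theorem abs_coupledLogSum_le {ι κ : Type*} [Fintype ι] [Fintype κ] [Nonempty κ] (B : κ → ℝ)
    {a b : κ → ι → ℝ} (ha : ∀ k q, a k q = 1 ∨ a k q = -1)
    (hb : ∀ k q, b k q = 1 ∨ b k q = -1) {c : ℝ} (hc : 0 ≤ c) (x y : ι → ℝ) :
    |coupledLogSum c B a b x y|
      ≤ log (Fintype.card κ) + ∑ k, |B k| + c * ∑ q, |x q| + c * ∑ q, |y q| := by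
  set M := ∑ k, |B k| + c * ∑ q, |x q| + c * ∑ q, |y q| with hM
  have hlin : ∀ (z α : ι → ℝ), (∀ q, α q = 1 ∨ α q = -1) → |∑ q, z q * α q| ≤ ∑ q, |z q| := by
    intro z α hα
    refine (Finset.abs_sum_le_sum_abs _ _).trans_eq (Finset.sum_congr rfl fun q _ => ?_)
    rcases hα q with h | h <;> simp [h]
  have hk : ∀ k, |B k + c * (∑ q, x q * a k q) + c * (∑ q, y q * b k q)| ≤ M := by
    intro k
    refine (abs_add_three _ _ _).trans ?_
    rw [abs_mul, abs_mul, abs_of_nonneg hc]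
    have h1 : |B k| ≤ ∑ k, |B k| :=
      Finset.single_le_sum (f := fun k => |B k|) (fun k _ => abs_nonneg _) (Finset.mem_univ k)
    have h2 := mul_le_mul_of_nonneg_left (hlin x (a k) (ha k)) hc
    have h3 := mul_le_mul_of_nonneg_left (hlin y (b k) (hb k)) hc
    linarith
  have hcard : (1 : ℝ) ≤ Fintype.card κ := by exact_mod_cast Fintype.card_pos
  have hlogc : 0 ≤ log (Fintype.card κ) := log_nonneg hcard
  have hpos : 0 < ∑ k, exp (B k + c * (∑ q, x q * a k q) + c * (∑ q, y q * b k q)) :=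
    Finset.sum_pos (fun k _ => exp_pos _) Finset.univ_nonempty
  have hup : ∑ k, exp (B k + c * (∑ q, x q * a k q) + c * (∑ q, y q * b k q))
      ≤ Fintype.card κ * exp M := by
    refine (Finset.sum_le_card_nsmul _ _ (exp M) fun k _ =>
      exp_le_exp.2 (abs_le.1 (hk k)).2).trans_eq ?_
    simp
  have hlow : exp (-M) ≤ ∑ k, exp (B k + c * (∑ q, x q * a k q) + c * (∑ q, y q * b k q)) := by
    obtain ⟨k⟩ := ‹Nonempty κ›
    exact (exp_le_exp.2 (abs_le.1 (hk k)).1).trans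
      (Finset.single_le_sum (f := fun k => exp (B k + c * (∑ q, x q * a k q)
        + c * (∑ q, y q * b k q))) (fun k _ => (exp_pos _).le) (Finset.mem_univ k))
  have h1 := log_le_log hpos hup
  have h2 := log_le_log (exp_pos _) hlow
  rw [log_mul (by positivity) (exp_pos _).ne', log_exp] at h1
  rw [log_exp] at h2
  rw [coupledLogSum, abs_le]
  constructor <;> linarith

theorem continuous_coupledLogSum {ι κ : Type*} [Fintype ι] [Fintype κ] [Nonempty κ] (c : ℝ)
    (B : κ → ℝ) (a b : κ → ι → ℝ) :
    Continuous fun z : (ι → ℝ) × (ι → ℝ) => coupledLogSum c B a b z.1 z.2 := by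
  unfold coupledLogSum
  refine Continuous.log (by fun_prop) fun z => ?_
  exact (Finset.sum_pos (fun k _ => exp_pos _) Finset.univ_nonempty).ne'

theorem integral_comp_of_measurePreserving {Ω Ω' : Type*} [MeasurableSpace Ω]
    [MeasurableSpace Ω'] {P : Measure Ω} {Q : Measure Ω'} {φ : Ω → Ω'}
    (hφ : MeasurePreserving φ P Q) {f : Ω' → ℝ} (hf : AEStronglyMeasurable f Q) :
    ∫ ω, f (φ ω) ∂P = ∫ x, f x ∂Q := by
  rw [← hφ.map_eq] at hf ⊢
  exact (integral_map hφ.measurable.aemeasurable hf).symm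

/-- Applying a measure-preserving map to a single coordinate preserves the product measure. -/
theorem measurePreserving_update {ι E : Type*} [Fintype ι] [DecidableEq ι] [MeasurableSpace E]
    {Q : Measure E} [IsProbabilityMeasure Q] {T : E → E} (hT : MeasurePreserving T Q Q) (p : ι) :
    MeasurePreserving (fun ω : ι → E => Function.update ω p (T (ω p)))
      (Measure.pi fun _ => Q) (Measure.pi fun _ => Q) := by
  have h := measurePreserving_pi (fun _ : ι => Q) (fun _ : ι => Q)
    (f := fun q => if q = p then T else id) fun q => by
      by_cases hq : q = p
      · simpa [hq] using hT
      · simpa [hq] using MeasurePreserving.id Q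
  convert h using 2 with ω
  funext q
  by_cases hq : q = p
  · subst hq; simp
  · simp [hq]

theorem integrable_comp_eval {ι E : Type*} [Fintype ι] [MeasurableSpace E]
    {Q : Measure E} [IsProbabilityMeasure Q] {f : E → ℝ} (hf : Integrable f Q) (p : ι) :
    Integrable (fun ω : ι → E => f (ω p)) (Measure.pi fun _ => Q) :=
  (measurePreserving_eval (fun _ : ι => Q) p).integrable_comp_of_integrable hf

theorem integrable_coupledLogSum {ι κ Ω : Type*} [Fintype ι] [Fintype κ] [Nonempty κ]
    [MeasurableSpace Ω] {P : Measure Ω} [IsFiniteMeasure P] (B : κ → ℝ) {a b : κ → ι → ℝ}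
    (ha : ∀ k q, a k q = 1 ∨ a k q = -1) (hb : ∀ k q, b k q = 1 ∨ b k q = -1) {c : ℝ}
    (hc : 0 ≤ c) {x y : Ω → ι → ℝ} (hx : ∀ q, Integrable (fun ω => x ω q) P)
    (hy : ∀ q, Integrable (fun ω => y ω q) P) :
    Integrable (fun ω => coupledLogSum c B a b (x ω) (y ω)) P := by
  have hxm : AEMeasurable x P := aemeasurable_pi_iff.2 fun q => (hx q).aemeasurable
  have hym : AEMeasurable y P := aemeasurable_pi_iff.2 fun q => (hy q).aemeasurable
  have hbound : Integrable (fun ω => log (Fintype.card κ) + ∑ k, |B k| + c * ∑ q, |x ω q|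
      + c * ∑ q, |y ω q|) P :=
    ((integrable_const _).add ((integrable_finsetSum _ fun q _ => (hx q).abs).const_mul c)).add
      ((integrable_finsetSum _ fun q _ => (hy q).abs).const_mul c)
  exact hbound.mono'
    ((continuous_coupledLogSum c B a b).measurable.comp_aemeasurable
      (hxm.prodMk hym)).aestronglyMeasurable
    (Filter.Eventually.of_forall fun ω => abs_coupledLogSum_le B ha hb hc _ _)

/-- Replacing the couplings `g` of the second system by `g'`, where a measure-preserving
map of the underlying space turns `(f, g)` into `(f', g')` and `g'` into `g`. -/
theorem integral_coupledLogSum_sub_le {ι κ E : Type*} [Fintype ι] [DecidableEq ι] [Fintype κ]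
    [Nonempty κ] [MeasurableSpace E] {Q : Measure E} [IsProbabilityMeasure Q] (B : κ → ℝ)
    {a b : κ → ι → ℝ} (ha : ∀ k q, a k q = 1 ∨ a k q = -1)
    (hb : ∀ k q, b k q = 1 ∨ b k q = -1) {c : ℝ} (hc : 0 ≤ c) {f f' g g' : E → ℝ} {T : E → E}
    (hT : MeasurePreserving T Q Q) (hfT : ∀ x, f (T x) = f' x)
    (hgT : ∀ x, g (T x) = g' x) (hgT' : ∀ x, g' (T x) = g x)
    (hmono : ∀ x, 0 ≤ (f' x - f x) * (g' x - g x))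
    (hf : Integrable f Q) (hg : Integrable g Q) (hg' : Integrable g' Q)
    (hfg : Integrable (fun x => f x * g x) Q) (hfg' : Integrable (fun x => f x * g' x) Q) :
    ∫ ω : ι → E, coupledLogSum c B a b (fun q => f (ω q)) (fun q => g (ω q))
        ∂(Measure.pi fun _ => Q)
      - ∫ ω : ι → E, coupledLogSum c B a b (fun q => f (ω q)) (fun q => g' (ω q))
        ∂(Measure.pi fun _ => Q)
      ≤ Fintype.card ι * (c ^ 2 * (∫ x, f x * g x ∂Q - ∫ x, f x * g' x ∂Q)) := by
  set P : Measure (ι → E) := Measure.pi fun _ => Q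
  let G : Finset ι → (ι → E) → ℝ := fun S ω =>
    coupledLogSum c B a b (fun q => f (ω q)) (fun q => if q ∈ S then g' (ω q) else g (ω q))
  have hGint : ∀ S, Integrable (G S) P := fun S =>
    integrable_coupledLogSum B ha hb hc (fun q => integrable_comp_eval hf q) fun q => by
      by_cases hq : q ∈ S
      · simpa only [hq, if_true] using integrable_comp_eval hg' q
      · simpa only [hq, if_false] using integrable_comp_eval hg q
  have e1 : ∫ x, f' x * g' x ∂Q = ∫ x, f x * g x ∂Q := by
    rw [← integral_comp_of_measurePreserving hT hfg.1]; simp only [hfT, hgT]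
  have e2 : ∫ x, f' x * g x ∂Q = ∫ x, f x * g' x ∂Q := by
    rw [← integral_comp_of_measurePreserving hT hfg'.1]; simp only [hfT, hgT']
  have i1 : Integrable (fun x => f' x * g' x) Q := by
    have := hT.integrable_comp_of_integrable hfg
    simpa only [Function.comp_def, hfT, hgT] using this
  have i2 : Integrable (fun x => f' x * g x) Q := by
    have := hT.integrable_comp_of_integrable hfg'
    simpa only [Function.comp_def, hfT, hgT'] using this
  have hexp : ∀ x, (f' x - f x) * (g' x - g x)
      = (f' x * g' x + f x * g x) - (f' x * g x + f x * g' x) := fun x => by ring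
  have s1 : Integrable (fun x => f' x * g' x + f x * g x) Q := i1.add hfg
  have s2 : Integrable (fun x => f' x * g x + f x * g' x) Q := i2.add hfg'
  have iprod : Integrable (fun x => (f' x - f x) * (g' x - g x)) Q := by
    simp only [hexp]
    exact s1.sub s2
  have eprod : ∫ x, (f' x - f x) * (g' x - g x) ∂Q
      = 2 * (∫ x, f x * g x ∂Q - ∫ x, f x * g' x ∂Q) := by
    simp only [hexp]
    rw [integral_sub s1 s2, integral_add i1 hfg, integral_add i2 hfg', e1, e2]
    ring
  have hstep : ∀ (S : Finset ι) (p : ι), p ∉ S → ∫ ω, G S ω ∂P - ∫ ω, G (insert p S) ω ∂P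
      ≤ c ^ 2 * (∫ x, f x * g x ∂Q - ∫ x, f x * g' x ∂Q) := by
    intro S p hp
    have hpt : ∀ ω, G S ω + G S (Function.update ω p (T (ω p))) - G (insert p S) ω
        - G (insert p S) (Function.update ω p (T (ω p)))
        ≤ c ^ 2 * ((f' (ω p) - f (ω p)) * (g' (ω p) - g (ω p))) := by
      intro ω
      have hx : (fun q => f (Function.update ω p (T (ω p)) q))
          = Function.update (fun q => f (ω q)) p (f' (ω p)) := by
        funext q
        by_cases hq : q = p
        · subst hq; simp [hfT]
        · simp [hq]
      have hy1 : (fun q => if q ∈ S then g' (Function.update ω p (T (ω p)) q)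
            else g (Function.update ω p (T (ω p)) q))
          = Function.update (fun q => if q ∈ S then g' (ω q) else g (ω q)) p (g' (ω p)) := by
        funext q
        by_cases hq : q = p
        · subst hq; simp [hgT, hp]
        · simp [hq]
      have hy2 : (fun q => if q ∈ insert p S then g' (ω q) else g (ω q))
          = Function.update (fun q => if q ∈ S then g' (ω q) else g (ω q)) p (g' (ω p)) := by
        funext q
        by_cases hq : q = p
        · subst hq; simp
        · simp [hq]
      have hy3 : (fun q => if q ∈ insert p S then g' (Function.update ω p (T (ω p)) q)
            else g (Function.update ω p (T (ω p)) q))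
          = fun q => if q ∈ S then g' (ω q) else g (ω q) := by
        funext q
        by_cases hq : q = p
        · subst hq; simp [hgT', hp]
        · simp [hq]
      have h := coupledLogSum_mixed_difference B ha hb hc (fun q => f (ω q))
        (fun q => if q ∈ S then g' (ω q) else g (ω q)) p (u := f' (ω p)) (v := g' (ω p))
        (by simpa [hp] using hmono (ω p))
      simp only [G, hx, hy1, hy2, hy3]
      simp only [hp, if_false] at h
      linarith
    have hT' := measurePreserving_update hT p (ι := ι)
    have j1 : Integrable (fun ω => G S (Function.update ω p (T (ω p)))) P :=
      hT'.integrable_comp_of_integrable (hGint S)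
    have j2 : Integrable (fun ω => G (insert p S) (Function.update ω p (T (ω p)))) P :=
      hT'.integrable_comp_of_integrable (hGint (insert p S))
    have hle := integral_mono
      ((((hGint S).add j1).sub (hGint (insert p S))).sub j2)
      ((integrable_comp_eval iprod p).const_mul (c ^ 2)) hpt
    rw [integral_const_mul,
      integral_comp_of_measurePreserving (measurePreserving_eval (fun _ : ι => Q) p) iprod.1, eprod,
      integral_sub' (((hGint S).add j1).sub (hGint (insert p S))) j2,
      integral_sub' ((hGint S).add j1) (hGint (insert p S)), integral_add' (hGint S) j1,
      integral_comp_of_measurePreserving hT' (hGint S).1,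
      integral_comp_of_measurePreserving hT' (hGint (insert p S)).1] at hle
    linarith
  have hall : ∀ S : Finset ι, ∫ ω, G ∅ ω ∂P - ∫ ω, G S ω ∂P
      ≤ S.card * (c ^ 2 * (∫ x, f x * g x ∂Q - ∫ x, f x * g' x ∂Q)) := by
    intro S
    induction S using Finset.induction_on with
    | empty => simp
    | insert p S hp ih =>
      have := hstep S p hp
      rw [Finset.card_insert_of_notMem hp]
      push_cast
      linarith
  simpa [G] using hall Finset.univ

theorem measurePreserving_gaussianPi_prod {ι E : Type*} [Fintype ι] [MeasurableSpace E]
    {Q : Measure E} [IsProbabilityMeasure Q] {φ : E → ℝ × ℝ}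
    (hφ : MeasurePreserving φ Q ((gaussianReal 0 1).prod (gaussianReal 0 1))) :
    MeasurePreserving (fun ω : ι → E => (fun q => (φ (ω q)).1, fun q => (φ (ω q)).2))
      (Measure.pi fun _ => Q) ((gaussianPi ι).prod (gaussianPi ι)) :=
  (measurePreserving_arrowProdEquivProdArrow ℝ ℝ ι (fun _ => gaussianReal 0 1)
    (fun _ => gaussianReal 0 1)).comp (measurePreserving_pi (fun _ => Q) _ fun _ => hφ)

theorem measurePreserving_tripleGauss {ι E : Type*} [Fintype ι] [MeasurableSpace E]
    {Q : Measure E} [IsProbabilityMeasure Q] {φ : E → ℝ × ℝ × ℝ}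
    (hφ : MeasurePreserving φ Q
      ((gaussianReal 0 1).prod ((gaussianReal 0 1).prod (gaussianReal 0 1)))) :
    MeasurePreserving (fun ω : ι → E =>
        (fun q => (φ (ω q)).1, fun q => (φ (ω q)).2.1, fun q => (φ (ω q)).2.2))
      (Measure.pi fun _ => Q) (tripleGauss ι) :=
  ((MeasurePreserving.id _).prod (measurePreserving_arrowProdEquivProdArrow ℝ ℝ ι
    (fun _ => gaussianReal 0 1) (fun _ => gaussianReal 0 1))).comp
    ((measurePreserving_arrowProdEquivProdArrow ℝ (ℝ × ℝ) ι (fun _ => gaussianReal 0 1)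
      (fun _ => (gaussianReal 0 1).prod (gaussianReal 0 1))).comp
      (measurePreserving_pi (fun _ => Q) _ fun _ => hφ))

theorem measurePreserving_prod_middle_swap {E : Type*} [MeasurableSpace E] (Q : Measure E)
    [IsProbabilityMeasure Q] :
    MeasurePreserving (fun x : (E × E) × E × E => ((x.1.1, x.2.1), (x.1.2, x.2.2)))
      ((Q.prod Q).prod (Q.prod Q)) ((Q.prod Q).prod (Q.prod Q)) := by
  have h1 := measurePreserving_prodAssoc Q Q (Q.prod Q)
  have h2 := measurePreserving_prodAssoc Q Q Q
  have h3 := (Measure.measurePreserving_swap (μ := Q) (ν := Q)).prod (MeasurePreserving.id Q)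
  have h4 := (MeasurePreserving.id Q).prod (h2.comp (h3.comp h2.symm))
  exact h1.symm.comp (h4.comp h1)

theorem measurePreserving_ou {c d : ℝ} (hcd : c ^ 2 + d ^ 2 = 1) :
    MeasurePreserving (fun x : ℝ × ℝ => c * x.1 + d * x.2)
      ((gaussianReal 0 1).prod (gaussianReal 0 1)) (gaussianReal 0 1) := by
  have hmul : ∀ s : ℝ, MeasurePreserving (fun x : ℝ => s * x) (gaussianReal 0 1)
      (gaussianReal 0 ⟨s ^ 2, sq_nonneg s⟩) := fun s =>
    ⟨by fun_prop, by rw [gaussianReal_map_const_mul, mul_zero, mul_one]; rfl⟩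
  have hadd : MeasurePreserving (fun x : ℝ × ℝ => x.1 + x.2)
      ((gaussianReal 0 ⟨c ^ 2, sq_nonneg c⟩).prod (gaussianReal 0 ⟨d ^ 2, sq_nonneg d⟩))
      (gaussianReal 0 1) := by
    refine ⟨by fun_prop, ?_⟩
    have := gaussianReal_conv_gaussianReal (m₁ := 0) (m₂ := 0) (v₁ := ⟨c ^ 2, sq_nonneg c⟩)
      (v₂ := ⟨d ^ 2, sq_nonneg d⟩)
    rw [Measure.conv] at this
    rw [this, add_zero]
    congr 1
    exact NNReal.eq hcd
  exact hadd.comp ((hmul c).prod (hmul d))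

theorem spin_mul_spin (s t : Bool) : spin s * spin t = 1 ∨ spin s * spin t = -1 := by
  cases s <;> cases t <;> simp [spin]

theorem log_sum_levyHam_eq (β aN lam : ℝ) (ρ : ℝ → ℝ) (J J' : Fin N × Fin N → ℝ) :
    log (∑ σ : Fin N → Bool, ∑ τ : Fin N → Bool,
        exp (β * levyHam N aN ρ J σ + β * levyHam N aN ρ J' τ + lam * N * overlap σ τ ^ 2))
      = coupledLogSum (β / aN)
        (fun k : (Fin N → Bool) × (Fin N → Bool) => lam * N * overlap k.1 k.2 ^ 2)
        (fun k q => spin (k.1 q.1) * spin (k.1 q.2)) (fun k q => spin (k.2 q.1) * spin (k.2 q.2))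
        (fun q => ρ (J q)) (fun q => ρ (J' q)) := by
  rw [coupledLogSum, Fintype.sum_prod_type]
  congr 1
  refine Finset.sum_congr rfl fun σ _ => Finset.sum_congr rfl fun τ _ => ?_
  congr 1
  simp only [levyHam]
  ring

/-- The two-point correlation of the Ornstein–Uhlenbeck flow as a squared conditional mean. -/
theorem lintegral_ou_mul_ou_eq {c d : ℝ} {h : ℝ → ℝ≥0∞} (hh : Measurable h) :
    ∫⁻ x : (ℝ × ℝ) × ℝ × ℝ, h (c * x.1.1 + d * x.2.1) * h (c * x.1.1 + d * x.2.2)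
        ∂((gaussianReal 0 1).prod (gaussianReal 0 1)).prod
          ((gaussianReal 0 1).prod (gaussianReal 0 1))
      = ∫⁻ z, (∫⁻ j, h (c * z + d * j) ∂gaussianReal 0 1) ^ 2 ∂gaussianReal 0 1 := by
  have hφ := (measurePreserving_fst (μ := gaussianReal 0 1) (ν := gaussianReal 0 1)).prod
    (MeasurePreserving.id ((gaussianReal 0 1).prod (gaussianReal 0 1)))
  refine (hφ.lintegral_comp (f := fun x : ℝ × ℝ × ℝ =>
    h (c * x.1 + d * x.2.1) * h (c * x.1 + d * x.2.2)) (by fun_prop)).trans ?_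
  rw [lintegral_prod _ (by fun_prop)]
  refine lintegral_congr fun z => ?_
  rw [lintegral_prod_mul (f := fun j => h (c * z + d * j)) (g := fun j => h (c * z + d * j))
    (by fun_prop) (by fun_prop), sq]

theorem integral_ou_mul_ou_le {c d p : ℝ} (hcd : c ^ 2 + d ^ 2 = 1) (hd : 0 < d)
    (hp : 1 + c ^ 2 < p) {ρ : ℝ → ℝ} (hρ : Measurable ρ)
    (hρp : Integrable (fun x => |ρ x| ^ p) (gaussianReal 0 1)) :
    Integrable (fun x : (ℝ × ℝ) × ℝ × ℝ =>
        ρ (c * x.1.1 + d * x.2.1) * ρ (c * x.1.1 + d * x.2.2))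
      (((gaussianReal 0 1).prod (gaussianReal 0 1)).prod
        ((gaussianReal 0 1).prod (gaussianReal 0 1))) ∧
    ∫ x : (ℝ × ℝ) × ℝ × ℝ, ρ (c * x.1.1 + d * x.2.1) * ρ (c * x.1.1 + d * x.2.2)
        ∂((gaussianReal 0 1).prod (gaussianReal 0 1)).prod
          ((gaussianReal 0 1).prod (gaussianReal 0 1))
      ≤ (∫ x, |ρ x| ^ p ∂gaussianReal 0 1) ^ (2 / p) *
        ((d ^ 2)⁻¹ * √((p - 1 + c ^ 2) / (p - 1 - c ^ 2))) := by
  have hp0 : 0 < p := by nlinarith [sq_nonneg c]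
  have hI : 0 ≤ ∫ x, |ρ x| ^ p ∂gaussianReal 0 1 := integral_nonneg fun x => by positivity
  have hlp : ∫⁻ x, ‖ρ x‖ₑ ^ p ∂gaussianReal 0 1
      = ENNReal.ofReal (∫ x, |ρ x| ^ p ∂gaussianReal 0 1) := by
    rw [ofReal_integral_eq_lintegral_ofReal hρp
      (Filter.Eventually.of_forall fun x => by positivity)]
    refine lintegral_congr fun x => ?_
    rw [Real.enorm_eq_ofReal_abs, ENNReal.ofReal_rpow_of_nonneg (abs_nonneg _) hp0.le]
  have hle := lintegral_ou_sq_le hcd hd hp (f := fun x => ‖ρ x‖ₑ) (by fun_prop)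
  rw [← lintegral_ou_mul_ou_eq (h := fun x => ‖ρ x‖ₑ) (by fun_prop), hlp,
    ENNReal.ofReal_rpow_of_nonneg hI (by positivity),
    ← ENNReal.ofReal_mul (by positivity)] at hle
  simp only [← enorm_mul] at hle
  refine ⟨⟨by fun_prop, hle.trans_lt ENNReal.ofReal_lt_top⟩, ?_⟩
  have h := (enorm_integral_le_lintegral_enorm _).trans hle
  rw [Real.enorm_eq_ofReal_abs, ENNReal.ofReal_le_ofReal_iff (by positivity)] at h
  exact (le_abs_self _).trans h

theorem levyF_sub_levyFinf_le {β aN lam t : ℝ} (hβ : 0 ≤ β) (haN : 0 < aN) (ht : 0 < t)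
    {ρ : ℝ → ℝ} (hρ : Monotone ρ) {p : ℝ} (hp : 1 + exp (-t) < p)
    (hρp : Integrable (fun x => |ρ x| ^ p) (gaussianReal 0 1)) (hN : 1 ≤ N) :
    levyF N β aN lam ρ t - levyFinf N β aN lam ρ
      ≤ N * (β / aN) ^ 2 * ((∫ x, |ρ x| ^ p ∂gaussianReal 0 1) ^ (2 / p) *
        ((1 - exp (-t))⁻¹ * √((p - 1 + exp (-t)) / (p - 1 - exp (-t))))) := by
  set γ := gaussianReal 0 1 with hγ
  set c := exp (-t / 2) with hc
  set d := √(1 - exp (-t)) with hd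
  have hs : exp (-t) < 1 := exp_lt_one_iff.2 (by linarith)
  have hc2 : c ^ 2 = exp (-t) := by
    rw [hc, ← exp_nat_mul]; congr 1; push_cast; ring
  have hd2 : d ^ 2 = 1 - exp (-t) := sq_sqrt (by linarith)
  have hd0 : 0 < d := sqrt_pos.2 (by linarith)
  have hc0 : 0 < c := exp_pos _
  have hcd : c ^ 2 + d ^ 2 = 1 := by rw [hc2, hd2]; ring
  have hρm : Measurable ρ := hρ.measurable
  obtain ⟨hfg, hM⟩ := integral_ou_mul_ou_le hcd hd0 (by rwa [hc2]) hρm hρp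
  rw [hc2, hd2] at hM
  have hρ1 : Integrable ρ γ := by
    have hp1 : 1 ≤ p := by linarith [exp_pos (-t)]
    refine ((hρp.add (integrable_const 1)).mono' hρm.aestronglyMeasurable
      (Filter.Eventually.of_forall fun x => ?_))
    simp only [Pi.add_apply, Real.norm_eq_abs]
    rcases le_total |ρ x| 1 with h | h
    · have : 0 ≤ |ρ x| ^ p := by positivity
      linarith
    · have := Real.rpow_le_rpow_of_exponent_le h hp1
      rw [Real.rpow_one] at this
      linarith
  let Q := (γ.prod γ).prod (γ.prod γ)
  have hpair : MeasurePreserving (fun x : (ℝ × ℝ) × ℝ × ℝ =>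
      (c * x.1.1 + d * x.2.1, c * x.1.2 + d * x.2.2)) Q (γ.prod γ) :=
    ((measurePreserving_ou hcd).prod (measurePreserving_ou hcd)).comp
      (measurePreserving_prod_middle_swap γ)
  have htriple : MeasurePreserving (fun x : (ℝ × ℝ) × ℝ × ℝ => (x.1.1, x.2.1, x.2.2)) Q
      (γ.prod (γ.prod γ)) :=
    (measurePreserving_fst (μ := γ) (ν := γ)).prod (MeasurePreserving.id (γ.prod γ))
  have hT : MeasurePreserving (fun x : (ℝ × ℝ) × ℝ × ℝ => (x.1.swap, x.2)) Q Q :=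
    (Measure.measurePreserving_swap (μ := γ) (ν := γ)).prod (MeasurePreserving.id (γ.prod γ))
  have hf : Integrable (fun x : (ℝ × ℝ) × ℝ × ℝ => ρ (c * x.1.1 + d * x.2.1)) Q :=
    (measurePreserving_fst.comp hpair).integrable_comp_of_integrable hρ1
  have hg' : Integrable (fun x : (ℝ × ℝ) × ℝ × ℝ => ρ (c * x.1.2 + d * x.2.2)) Q :=
    (measurePreserving_snd.comp hpair).integrable_comp_of_integrable hρ1
  have hg : Integrable (fun x : (ℝ × ℝ) × ℝ × ℝ => ρ (c * x.1.1 + d * x.2.2)) Q :=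
    hT.integrable_comp_of_integrable hg'
  have hfg' : Integrable (fun x : (ℝ × ℝ) × ℝ × ℝ =>
      ρ (c * x.1.1 + d * x.2.1) * ρ (c * x.1.2 + d * x.2.2)) Q :=
    hpair.integrable_comp_of_integrable (hρ1.mul_prod hρ1)
  have hfg'0 : 0 ≤ ∫ x : (ℝ × ℝ) × ℝ × ℝ,
      ρ (c * x.1.1 + d * x.2.1) * ρ (c * x.1.2 + d * x.2.2) ∂Q := by
    have := integral_comp_of_measurePreserving hpair (hρ1.mul_prod hρ1).1
    rw [integral_prod_mul] at this
    rw [this]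
    exact mul_self_nonneg _
  have hmono : ∀ x : (ℝ × ℝ) × ℝ × ℝ,
      0 ≤ (ρ (c * x.1.2 + d * x.2.1) - ρ (c * x.1.1 + d * x.2.1))
        * (ρ (c * x.1.2 + d * x.2.2) - ρ (c * x.1.1 + d * x.2.2)) := by
    intro x
    rcases le_total x.1.1 x.1.2 with h | h
    · exact mul_nonneg (sub_nonneg.2 (hρ (by gcongr))) (sub_nonneg.2 (hρ (by gcongr)))
    · exact mul_nonneg_of_nonpos_of_nonpos (sub_nonpos.2 (hρ (by gcongr)))
        (sub_nonpos.2 (hρ (by gcongr)))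
  let B : (Fin N → Bool) × (Fin N → Bool) → ℝ := fun k => lam * N * overlap k.1 k.2 ^ 2
  let a : (Fin N → Bool) × (Fin N → Bool) → Fin N × Fin N → ℝ :=
    fun k q => spin (k.1 q.1) * spin (k.1 q.2)
  let b : (Fin N → Bool) × (Fin N → Bool) → Fin N × Fin N → ℝ :=
    fun k q => spin (k.2 q.1) * spin (k.2 q.2)
  have hmain := integral_coupledLogSum_sub_le (ι := Fin N × Fin N) B
    (a := a) (b := b) (fun _ _ => spin_mul_spin _ _) (fun _ _ => spin_mul_spin _ _)
    (div_nonneg hβ haN.le) hT (fun _ => rfl) (fun _ => rfl) (fun _ => rfl) hmono hf hg hg' hfg hfg'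
  have hsm : Measurable fun z : (Fin N × Fin N → ℝ) × (Fin N × Fin N → ℝ) =>
      coupledLogSum (β / aN) B a b (fun q => ρ (z.1 q)) (fun q => ρ (z.2 q)) :=
    (continuous_coupledLogSum (β / aN) B a b).measurable.comp
      (f := fun z : (Fin N × Fin N → ℝ) × (Fin N × Fin N → ℝ) =>
        (fun q => ρ (z.1 q), fun q => ρ (z.2 q))) (by fun_prop)
  have hF : levyF N β aN lam ρ t = (∫ ω : Fin N × Fin N → (ℝ × ℝ) × ℝ × ℝ,
      coupledLogSum (β / aN) B a b (fun q => ρ (c * (ω q).1.1 + d * (ω q).2.1))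
        (fun q => ρ (c * (ω q).1.1 + d * (ω q).2.2)) ∂(Measure.pi fun _ => Q)) / N := by
    simp only [levyF, log_sum_levyHam_eq]
    congr 1
    exact (integral_comp_of_measurePreserving (measurePreserving_tripleGauss htriple)
      (hsm.comp (f := fun ω : (Fin N × Fin N → ℝ) × (Fin N × Fin N → ℝ) × (Fin N × Fin N → ℝ) =>
        (fun p => c * ω.1 p + d * ω.2.1 p, fun p => c * ω.1 p + d * ω.2.2 p))
        (by fun_prop)).aestronglyMeasurable).symm
  have hFinf : levyFinf N β aN lam ρ = (∫ ω : Fin N × Fin N → (ℝ × ℝ) × ℝ × ℝ,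
      coupledLogSum (β / aN) B a b (fun q => ρ (c * (ω q).1.1 + d * (ω q).2.1))
        (fun q => ρ (c * (ω q).1.2 + d * (ω q).2.2)) ∂(Measure.pi fun _ => Q)) / N := by
    simp only [levyFinf, log_sum_levyHam_eq]
    congr 1
    exact (integral_comp_of_measurePreserving measurePreserving_snd
      hsm.aestronglyMeasurable).trans (integral_comp_of_measurePreserving
        (measurePreserving_gaussianPi_prod hpair) hsm.aestronglyMeasurable).symm
  have hN0 : (0 : ℝ) < N := by exact_mod_cast hN
  rw [hF, hFinf, ← sub_div, div_le_iff₀ hN0]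
  refine hmain.trans ?_
  rw [Fintype.card_prod, Fintype.card_fin, Nat.cast_mul]
  calc (N : ℝ) * N * ((β / aN) ^ 2 * _)
      ≤ (N : ℝ) * N * ((β / aN) ^ 2 * ((∫ x, |ρ x| ^ p ∂γ) ^ (2 / p) *
        ((1 - exp (-t))⁻¹ * √((p - 1 + exp (-t)) / (p - 1 - exp (-t)))))) := by
        gcongr
        exact (sub_le_self _ hfg'0).trans hM
    _ = _ := by ring

theorem sqrt_mehler_ratio_le {b s : ℝ} (hb1 : 1 < b) (hb2 : b ≤ 2) (hs0 : 0 < s) (hs1 : s ≤ 1) :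
    √((b * (1 + s) - 1 + s) / (b * (1 + s) - 1 - s))
      ≤ 2 * (∫ x, |x| ^ (b / (b - 1)) ∂gaussianReal 0 1) ^ (2 * (b - 1) / b) := by
  have hb : 0 < b - 1 := by linarith
  have hq : 2 ≤ b / (b - 1) := by rw [le_div_iff₀ hb]; linarith
  have h := sqrt_le_gaussian_norm hq
  rw [show 2 / (b / (b - 1)) = 2 * (b - 1) / b by field_simp] at h
  refine le_trans (sqrt_le_sqrt ?_) h
  have h1 : 0 < b * (1 + s) - 1 - s := by nlinarith
  rw [div_le_div_iff₀ h1 hb]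
  linarith [mul_nonneg (sub_nonneg.2 hs1) hb.le]

/-- For the Lévy model coupled free energy: for `λ > 0`,
`t > -ln(α-1)` and `1 < b < α/(1+e^{-t})`,
`F_N(t,λ) − F_N(∞,λ) ≤ (2Nβ²/a_N²) (1-e^{-t})⁻¹ (E|J|^{b/(b-1)})^{2(b-1)/b}
(E|ρ(J)|^{b(1+e^{-t})})^{2/((1+e^{-t})b)}`. -/
theorem stmt16
    (αs : ℝ) (hα1 : 1 < αs) (hα2 : αs < 2)
    (L : ℝ → ℝ) (hLpos : ∀ x > 0, 0 < L x)
    (hLslow : ∀ s > 0, Filter.Tendsto (fun x => L (s * x) / L x) Filter.atTop (nhds 1))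
    (ρ : ℝ → ℝ) (hρmono : Monotone ρ)
    (hsymm : Measure.map (fun x => ρ x) (gaussianReal 0 1)
      = Measure.map (fun x => - ρ x) (gaussianReal 0 1))
    (htail : ∀ x > 0, ((gaussianReal 0 1) {j | x < |ρ j|}).toReal = L x / x ^ αs)
    (N : ℕ) (hN : 1 ≤ N) (β : ℝ) (hβ : 0 ≤ β) (aN : ℝ) (haN : 0 < aN)
    (lam t b : ℝ) (hlam : 0 < lam) (ht : -Real.log (αs - 1) < t)
    (hb1 : 1 < b) (hb2 : b < αs / (1 + Real.exp (-t))) :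
    levyF N β aN lam ρ t - levyFinf N β aN lam ρ
      ≤ 2 * N * β ^ 2 / aN ^ 2 * (1 - Real.exp (-t))⁻¹ *
          (∫ x, |x| ^ (b / (b - 1)) ∂gaussianReal 0 1) ^ (2 * (b - 1) / b) *
          (∫ x, |ρ x| ^ (b * (1 + Real.exp (-t))) ∂gaussianReal 0 1) ^
            (2 / ((1 + Real.exp (-t)) * b)) := by
  have hα : 0 < αs - 1 := by linarith
  have hs : exp (-t) < αs - 1 := by
    rw [← exp_log hα]
    exact exp_lt_exp.2 (by linarith)
  have hs0 := exp_pos (-t)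
  have ht0 : 0 < t := by
    have := exp_lt_one_iff.1 (hs.trans (by linarith))
    linarith
  rw [lt_div_iff₀ (by positivity)] at hb2
  have hbs : b ≤ 2 := by nlinarith
  have hint : Integrable (fun x => |ρ x| ^ (b * (1 + exp (-t)))) (gaussianReal 0 1) :=
    integrable_abs_rpow_of_regularly_varying_tail hρmono.measurable hLpos (hLslow 2 two_pos) htail
      (by positivity) hb2
  have h := levyF_sub_levyFinf_le (lam := lam) hβ haN ht0 hρmono (p := b * (1 + exp (-t)))
    (by nlinarith) hint hN
  refine h.trans ?_
  have hr := sqrt_mehler_ratio_le hb1 hbs hs0 (hs.trans (by linarith)).le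
  have hs1 : 0 < 1 - exp (-t) := by linarith
  have hI : 0 ≤ ∫ x, |ρ x| ^ (b * (1 + exp (-t))) ∂gaussianReal 0 1 :=
    integral_nonneg fun x => by positivity
  refine (mul_le_mul_of_nonneg_left (mul_le_mul_of_nonneg_left
    (mul_le_mul_of_nonneg_left hr (inv_nonneg.2 hs1.le)) (by positivity))
    (by positivity)).trans_eq ?_
  rw [mul_comm b]
  ring
end
end

section
/- Consider the generalized short-range model with Gaussian disorder, i.e., ρ_p(x) = x for all 2 ≤ p ≤ Δ, under the continuous perturbation with inverse temperature β > 0. Then for every t ≥ 0, E⟨R(σ,τ)²⟩_t ≥ E⟨R(σ,τ)²⟩_0 − 6√t · √β · |E|^{3/4}. In particular, if t ≤ 12^{−2} β^{−1} |E|^{−3/2} (E⟨R(σ¹,σ²)²⟩)², then E⟨R(σ,τ)²⟩_t > (1/2) · E⟨R(σ¹,σ²)²⟩, where ⟨R(σ¹,σ²)²⟩ = ⟨R(σ,τ)²⟩_0 is the Gibbs average of the squared overlap of two independent replicas from the unperturbed Gibbs measure G_{J,β}. -/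
open MeasureTheory ProbabilityTheory Real Finset

noncomputable section

/-! ### Spin models on hypergraphs -/

variable {N : ℕ}

/-! ### Finite Gibbs measures -/

lemma sub_mul_log_sub_log_ge {a b : ℝ} (ha : 0 < a) (hb : 0 < b) :
    (a - b) ^ 2 / (a + b) ≤ (a - b) * (Real.log a - Real.log b) := by
  wlog h : b ≤ a generalizing a b
  · have := this hb ha (le_of_not_ge h)
    rw [add_comm a b]
    linarith [show (b - a) ^ 2 / (b + a) = (a - b) ^ 2 / (b + a) by ring]
  have h1 : (a - b) / (a + b) ≤ Real.log a - Real.log b := by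
    have h2 := Real.one_sub_inv_le_log_of_pos (div_pos ha hb)
    rw [Real.log_div ha.ne' hb.ne', inv_div] at h2
    refine le_trans ?_ h2
    rw [div_le_iff₀ (by positivity), sub_mul, div_mul_eq_mul_div]
    have : b * (a + b) / a ≤ 2 * b := by
      rw [div_le_iff₀ ha]; nlinarith
    linarith
  calc (a - b) ^ 2 / (a + b) = (a - b) * ((a - b) / (a + b)) := by ring
    _ ≤ _ := mul_le_mul_of_nonneg_left h1 (sub_nonneg.2 h)

/-- A Pinsker-type inequality for the symmetrized relative entropy of two positive
probability vectors. -/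
lemma sq_sum_mul_sub_le {Ω : Type*} [Fintype Ω] {p q f : Ω → ℝ}
    (hp : ∀ x, 0 < p x) (hq : ∀ x, 0 < q x) (hp1 : ∑ x, p x = 1) (hq1 : ∑ x, q x = 1)
    (hf : ∀ x, |f x| ≤ 1) :
    (∑ x, f x * (p x - q x)) ^ 2 ≤
      2 * ∑ x, (p x - q x) * (Real.log (p x) - Real.log (q x)) := by
  have hpq : ∀ x, 0 < p x + q x := fun x => add_pos (hp x) (hq x)
  have hCS := Finset.sum_sq_le_sum_mul_sum_of_sq_le_mul Finset.univ
    (r := fun x => f x * (p x - q x)) (f := fun x => p x + q x)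
    (g := fun x => f x ^ 2 * ((p x - q x) ^ 2 / (p x + q x)))
    (fun x _ => (hpq x).le)
    (fun x _ => mul_nonneg (sq_nonneg _) (div_nonneg (sq_nonneg _) (hpq x).le))
    (fun x _ => by have := (hpq x).ne'; exact le_of_eq (by field_simp))
  have h2 : ∑ x, (p x + q x) = 2 := by rw [Finset.sum_add_distrib, hp1, hq1]; norm_num
  rw [h2] at hCS
  refine hCS.trans (mul_le_mul_of_nonneg_left (Finset.sum_le_sum fun x _ => ?_) zero_le_two)
  refine le_trans ?_ (sub_mul_log_sub_log_ge (hp x) (hq x))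
  exact mul_le_of_le_one_left (div_nonneg (sq_nonneg _) (hpq x).le)
    ((sq_le_one_iff_abs_le_one _).2 (hf x))

section Gibbs

variable (β : ℝ) (H K : (Fin N → Bool) → ℝ)

/-- The mass which the Gibbs measure gives to a configuration. -/
def gibbsWeight (σ : Fin N → Bool) : ℝ :=
  Real.exp (β * H σ) / ∑ τ, Real.exp (β * H τ)

lemma sum_exp_pos : 0 < ∑ τ : Fin N → Bool, Real.exp (β * H τ) :=
  Finset.sum_pos (fun _ _ => Real.exp_pos _) Finset.univ_nonempty

lemma gibbsWeight_pos (σ : Fin N → Bool) : 0 < gibbsWeight β H σ :=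
  div_pos (Real.exp_pos _) (sum_exp_pos β H)

lemma sum_gibbsWeight : ∑ σ, gibbsWeight β H σ = 1 := by
  simp only [gibbsWeight, ← Finset.sum_div]
  exact div_self (sum_exp_pos β H).ne'

lemma gibbs_eq_sum (f : (Fin N → Bool) → ℝ) :
    gibbs β H f = ∑ σ, f σ * gibbsWeight β H σ := by
  simp only [gibbs, gibbsWeight, Finset.sum_div, mul_div_assoc]

lemma abs_gibbs_le_one {f : (Fin N → Bool) → ℝ} (hf : ∀ σ, |f σ| ≤ 1) :
    |gibbs β H f| ≤ 1 := by
  rw [gibbs_eq_sum, ← sum_gibbsWeight β H]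
  refine (Finset.abs_sum_le_sum_abs _ _).trans (Finset.sum_le_sum fun σ _ => ?_)
  rw [abs_mul, abs_of_pos (gibbsWeight_pos β H σ)]
  exact mul_le_of_le_one_left (gibbsWeight_pos β H σ).le (hf σ)

lemma gibbs2_eq_sum (f : (Fin N → Bool) → (Fin N → Bool) → ℝ) :
    gibbs2 β H K f = ∑ σ, ∑ τ, f σ τ * (gibbsWeight β H σ * gibbsWeight β K τ) := by
  simp only [gibbs2, gibbsWeight, Real.exp_add, ← Finset.sum_mul_sum, Finset.sum_div]
  refine Finset.sum_congr rfl fun σ _ => Finset.sum_congr rfl fun τ _ => ?_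
  rw [div_mul_div_comm, mul_div_assoc]

lemma sq_gibbs_sub_le {f : (Fin N → Bool) → ℝ} (hf : ∀ σ, |f σ| ≤ 1) :
    (gibbs β H f - gibbs β K f) ^ 2 ≤
      2 * (β * (gibbs β H (fun σ => H σ - K σ) - gibbs β K (fun σ => H σ - K σ))) := by
  have h := sq_sum_mul_sub_le (gibbsWeight_pos β H) (gibbsWeight_pos β K)
    (sum_gibbsWeight β H) (sum_gibbsWeight β K) hf
  have hlog : ∀ (L : (Fin N → Bool) → ℝ) σ, Real.log (gibbsWeight β L σ) =
      β * L σ - Real.log (∑ τ, Real.exp (β * L τ)) := fun L σ => by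
    rw [gibbsWeight, Real.log_div (Real.exp_pos _).ne' (sum_exp_pos β L).ne', Real.log_exp]
  set c := Real.log (∑ τ, Real.exp (β * K τ)) - Real.log (∑ τ, Real.exp (β * H τ)) with hc
  have hrhs : ∑ σ, (gibbsWeight β H σ - gibbsWeight β K σ) *
        (Real.log (gibbsWeight β H σ) - Real.log (gibbsWeight β K σ)) =
      β * (gibbs β H (fun σ => H σ - K σ) - gibbs β K (fun σ => H σ - K σ)) := by
    have h0 : ∑ σ, (gibbsWeight β H σ - gibbsWeight β K σ) * c = 0 := by
      rw [← Finset.sum_mul, Finset.sum_sub_distrib, sum_gibbsWeight, sum_gibbsWeight]; simp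
    rw [gibbs_eq_sum, gibbs_eq_sum, ← Finset.sum_sub_distrib, Finset.mul_sum, ← sub_zero (∑ σ, _ * _),
      ← h0, ← Finset.sum_sub_distrib]
    refine Finset.sum_congr rfl fun σ _ => ?_
    rw [hlog, hlog, hc]; ring
  rw [hrhs] at h
  simpa only [gibbs_eq_sum, ← Finset.sum_sub_distrib, mul_sub] using h

end Gibbs

/-! ### Overlaps and two-point functions -/

lemma abs_spin (b : Bool) : |spin b| = 1 := by cases b <;> simp [spin]

lemma abs_sigEdge (σ : Fin N → Bool) (e : Finset (Fin N)) : |sigEdge σ e| = 1 := by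
  simp [sigEdge, Finset.abs_prod, abs_spin]

/-- The two-point function `⟨σ_i σ_j⟩`. -/
def twoPoint (β : ℝ) (H : (Fin N → Bool) → ℝ) (i j : Fin N) : ℝ :=
  gibbs β H fun σ => spin (σ i) * spin (σ j)

lemma twoPoint_self (β : ℝ) (H : (Fin N → Bool) → ℝ) (i : Fin N) : twoPoint β H i i = 1 := by
  have h : ∀ b, spin b * spin b = 1 := fun b => by cases b <;> simp [spin]
  simp [twoPoint, gibbs_eq_sum, h, sum_gibbsWeight]

lemma sum_sum_comm_sum_sum {Ω ι : Type*} [Fintype Ω] [Fintype ι] (F : Ω → Ω → ι → ι → ℝ) :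
    ∑ x, ∑ y, ∑ i, ∑ j, F x y i j = ∑ i, ∑ j, ∑ x, ∑ y, F x y i j := by
  calc ∑ x, ∑ y, ∑ i, ∑ j, F x y i j = ∑ x, ∑ i, ∑ y, ∑ j, F x y i j :=
        Finset.sum_congr rfl fun x _ => Finset.sum_comm
    _ = ∑ i, ∑ x, ∑ y, ∑ j, F x y i j := Finset.sum_comm
    _ = ∑ i, ∑ x, ∑ j, ∑ y, F x y i j :=
        Finset.sum_congr rfl fun i _ => Finset.sum_congr rfl fun x _ => Finset.sum_comm
    _ = _ := Finset.sum_congr rfl fun i _ => Finset.sum_comm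

lemma gibbs2_overlap_sq (β : ℝ) (H K : (Fin N → Bool) → ℝ) :
    gibbs2 β H K (fun σ τ => overlap σ τ ^ 2) =
      (∑ i, ∑ j, twoPoint β H i j * twoPoint β K i j) / N ^ 2 := by
  have h : ∀ σ τ : Fin N → Bool, overlap σ τ ^ 2 =
      ∑ i, ∑ j, spin (σ i) * spin (σ j) * (spin (τ i) * spin (τ j)) / N ^ 2 := fun σ τ => by
    simp only [overlap, sq, Finset.sum_mul_sum, Finset.sum_div]
    refine Finset.sum_congr rfl fun i _ => Finset.sum_congr rfl fun j _ => ?_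
    ring
  simp only [gibbs2_eq_sum, h, twoPoint, gibbs_eq_sum, Finset.sum_mul_sum, Finset.sum_div]
  simp only [Finset.sum_mul]
  rw [sum_sum_comm_sum_sum]
  refine Finset.sum_congr rfl fun i _ => Finset.sum_congr rfl fun j _ =>
    Finset.sum_congr rfl fun σ _ => Finset.sum_congr rfl fun τ _ => ?_
  ring

lemma gibbs2_overlap_sq_nonneg (β : ℝ) (H K : (Fin N → Bool) → ℝ) :
    0 ≤ gibbs2 β H K (fun σ τ => overlap σ τ ^ 2) := by
  rw [gibbs2_eq_sum]
  exact Finset.sum_nonneg fun σ _ => Finset.sum_nonneg fun τ _ => mul_nonneg (sq_nonneg _)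
    (mul_pos (gibbsWeight_pos β H σ) (gibbsWeight_pos β K τ)).le

lemma abs_twoPoint_le_one (β : ℝ) (H : (Fin N → Bool) → ℝ) (i j : Fin N) :
    |twoPoint β H i j| ≤ 1 :=
  abs_gibbs_le_one β H fun σ => by rw [abs_mul, abs_spin, abs_spin, one_mul]

lemma sum_sum_div_sq_le (hN : 1 ≤ N) {f : Fin N → Fin N → ℝ} {C : ℝ} (hf : ∀ i j, f i j ≤ C) :
    (∑ i, ∑ j, f i j) / N ^ 2 ≤ C := by
  have hN' : (0 : ℝ) < N := by exact_mod_cast hN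
  rw [div_le_iff₀ (by positivity)]
  calc ∑ i, ∑ j, f i j ≤ ∑ _i : Fin N, ∑ _j : Fin N, C :=
        Finset.sum_le_sum fun i _ => Finset.sum_le_sum fun j _ => hf i j
    _ = C * N ^ 2 := by simp; ring

lemma gibbs2_overlap_sq_le_one (hN : 1 ≤ N) (β : ℝ) (H K : (Fin N → Bool) → ℝ) :
    gibbs2 β H K (fun σ τ => overlap σ τ ^ 2) ≤ 1 := by
  rw [gibbs2_overlap_sq]
  refine sum_sum_div_sq_le hN fun i j => (le_abs_self _).trans ?_
  rw [abs_mul]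
  exact mul_le_one₀ (abs_twoPoint_le_one β H i j) (abs_nonneg _) (abs_twoPoint_le_one β K i j)

lemma inv_le_gibbs2_overlap_sq_self (hN : 1 ≤ N) (β : ℝ) (H : (Fin N → Bool) → ℝ) :
    (N : ℝ)⁻¹ ≤ gibbs2 β H H (fun σ τ => overlap σ τ ^ 2) := by
  have hN' : (0 : ℝ) < N := by exact_mod_cast hN
  rw [gibbs2_overlap_sq, le_div_iff₀ (by positivity)]
  calc (N : ℝ)⁻¹ * N ^ 2 = ∑ _i : Fin N, (1 : ℝ) := by simp; field_simp
    _ ≤ _ := Finset.sum_le_sum fun i _ => by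
      have := Finset.single_le_sum (f := fun j => twoPoint β H i j * twoPoint β H i j)
        (fun j _ => mul_self_nonneg _) (Finset.mem_univ i)
      simpa [twoPoint_self] using this

lemma gibbs2_overlap_sq_add_sub_le (hN : 1 ≤ N) (β : ℝ) (H K : (Fin N → Bool) → ℝ) :
    gibbs2 β H H (fun σ τ => overlap σ τ ^ 2) + gibbs2 β K K (fun σ τ => overlap σ τ ^ 2) -
        2 * gibbs2 β H K (fun σ τ => overlap σ τ ^ 2) ≤
      2 * (β * (gibbs β H (fun σ => H σ - K σ) - gibbs β K (fun σ => H σ - K σ))) := by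
  refine le_trans (le_of_eq ?_) (sum_sum_div_sq_le hN
    (f := fun i j => (twoPoint β H i j - twoPoint β K i j) ^ 2) fun i j =>
      sq_gibbs_sub_le β H K fun σ => by rw [abs_mul, abs_spin, abs_spin, one_mul])
  simp only [gibbs2_overlap_sq, sub_sq, Finset.sum_add_distrib, Finset.sum_sub_distrib, mul_assoc,
    ← Finset.mul_sum, sq (twoPoint _ _ _ _)]
  ring

/-! ### The Gaussian model -/

section Gaussian

variable {ι : Type*} [Fintype ι]

lemma measurePreserving_eval_gaussianPi (e : ι) :
    MeasurePreserving (fun J : ι → ℝ => J e) (gaussianPi ι) (gaussianReal 0 1) :=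
  measurePreserving_eval (fun _ => gaussianReal 0 1) e

lemma memLp_eval_gaussianPi (e : ι) : MemLp (fun J : ι → ℝ => J e) 2 (gaussianPi ι) :=
  (memLp_id_gaussianReal' (μ := 0) (v := 1) 2 (by simp)).comp_measurePreserving
    (measurePreserving_eval_gaussianPi e)

lemma integrable_eval_gaussianPi (e : ι) : Integrable (fun J : ι → ℝ => J e) (gaussianPi ι) :=
  (memLp_eval_gaussianPi e).integrable (by norm_num)

lemma integral_eval_gaussianPi (e : ι) : ∫ J, J e ∂gaussianPi ι = 0 := by
  rw [← integral_id_gaussianReal (μ := 0) (v := 1), ← (measurePreserving_eval_gaussianPi e).map_eq,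
    integral_map (measurable_pi_apply e).aemeasurable (by fun_prop)]

lemma integral_eval_sq_gaussianPi (e : ι) : ∫ J, J e ^ 2 ∂gaussianPi ι = 1 := by
  have h : Var[id; gaussianReal 0 1] = 1 := by simp [variance_id_gaussianReal]
  rw [variance_eq_integral (by fun_prop)] at h
  simp only [id, integral_id_gaussianReal, sub_zero] at h
  rw [← h, ← (measurePreserving_eval_gaussianPi e).map_eq,
    integral_map (measurable_pi_apply e).aemeasurable (by fun_prop)]

instance isGaussian_gaussianPi : IsGaussian (gaussianPi ι) := by
  have h : HasGaussianLaw (fun (J : ι → ℝ) (e : ι) => J e) (gaussianPi ι) :=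
    iIndepFun.hasGaussianLaw (X := fun e (J : ι → ℝ) => J e)
      (fun e => ⟨by
        have := (measurePreserving_eval_gaussianPi e).map_eq
        rw [this]; infer_instance⟩)
      (iIndepFun_pi (X := fun _ => id) fun _ => aemeasurable_id)
  simpa using h.isGaussian_map

lemma map_rotation_pairGauss (θ : ℝ) :
    MeasurePreserving (ContinuousLinearMap.rotation θ) (pairGauss ι) (pairGauss ι) := by
  refine ⟨by fun_prop, IsGaussian.map_rotation_eq_self ?_ θ⟩
  ext e
  simp only [id]
  rw [eval_integral fun e => integrable_eval_gaussianPi e]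
  exact integral_eval_gaussianPi e

lemma rotation_arccos_fst {t : ℝ} (ht : 0 ≤ t) (ω : (ι → ℝ) × (ι → ℝ)) :
    (ContinuousLinearMap.rotation (Real.arccos (Real.exp (-t))) ω).1 =
      contPerturb t ω.1 ω.2 := by
  have h1 : Real.exp (-t) ≤ 1 := Real.exp_le_one_iff.2 (by linarith)
  ext e
  simp only [ContinuousLinearMap.rotation_apply, contPerturb, Pi.add_apply, Pi.smul_apply,
    smul_eq_mul, Real.sin_arccos, Real.cos_arccos (by linarith [Real.exp_pos (-t)]) h1]
  rw [← Real.exp_nat_mul]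
  congr 5; push_cast; ring

lemma measurePreserving_contPerturb {t : ℝ} (ht : 0 ≤ t) :
    MeasurePreserving (fun ω : (ι → ℝ) × (ι → ℝ) => contPerturb t ω.1 ω.2)
      (pairGauss ι) (gaussianPi ι) := by
  have := (measurePreserving_fst (μ := gaussianPi ι) (ν := gaussianPi ι)).comp
    (map_rotation_pairGauss (ι := ι) (Real.arccos (Real.exp (-t))))
  convert this using 1
  ext1 ω
  exact (rotation_arccos_fst ht ω).symm

variable {f : (ι → ℝ) → ℝ}

lemma integral_comp_contPerturb {t : ℝ} (ht : 0 ≤ t) (hf : Continuous f) :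
    ∫ ω : (ι → ℝ) × (ι → ℝ), f (contPerturb t ω.1 ω.2) ∂pairGauss ι =
      ∫ J, f J ∂gaussianPi ι := by
  have hp := measurePreserving_contPerturb (ι := ι) ht
  rw [← hp.map_eq, integral_map hp.measurable.aemeasurable hf.aestronglyMeasurable]

lemma integrable_eval_mul (hf : Continuous f) (hb : ∀ J, |f J| ≤ 1) (e : ι) :
    Integrable (fun J => J e * f J) (gaussianPi ι) :=
  (integrable_eval_gaussianPi e).mul_bdd (c := 1) hf.aestronglyMeasurable (ae_of_all _ hb)

lemma integral_eval_mul_le_one (hf : Continuous f) (hb : ∀ J, |f J| ≤ 1) (e : ι) :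
    ∫ J, J e * f J ∂gaussianPi ι ≤ 1 := by
  have hsq := (memLp_eval_gaussianPi e).integrable_sq
  calc ∫ J, J e * f J ∂gaussianPi ι ≤ ∫ J, (J e ^ 2 + 1) / 2 ∂gaussianPi ι := by
        refine integral_mono (integrable_eval_mul hf hb e)
          ((hsq.add (integrable_const 1)).div_const 2) fun J => ?_
        have := (sq_le_one_iff_abs_le_one _).2 (hb J)
        dsimp only
        nlinarith [sq_nonneg (J e - f J)]
    _ = 1 := by
        rw [integral_div, integral_add hsq (integrable_const 1), integral_eval_sq_gaussianPi]
        simp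

lemma integral_linearComb_mul (hf : Continuous f) (hb : ∀ J, |f J| ≤ 1) (e : ι) (a b : ℝ) :
    Integrable (fun ω : (ι → ℝ) × (ι → ℝ) => (a * ω.1 e + b * ω.2 e) * f ω.1) (pairGauss ι) ∧
    ∫ ω : (ι → ℝ) × (ι → ℝ), (a * ω.1 e + b * ω.2 e) * f ω.1 ∂pairGauss ι =
      a * ∫ J, J e * f J ∂gaussianPi ι := by
  have h1 : Integrable (fun ω : (ι → ℝ) × (ι → ℝ) => a * (ω.1 e * f ω.1)) (pairGauss ι) :=
    ((integrable_eval_mul hf hb e).comp_fst (gaussianPi ι)).const_mul a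
  have hfi : Integrable f (gaussianPi ι) :=
    Integrable.of_bound hf.aestronglyMeasurable 1 (ae_of_all _ hb)
  have h2 : Integrable (fun ω : (ι → ℝ) × (ι → ℝ) => b * (f ω.1 * ω.2 e)) (pairGauss ι) :=
    (hfi.mul_prod (integrable_eval_gaussianPi e)).const_mul b
  have heq : (fun ω : (ι → ℝ) × (ι → ℝ) => (a * ω.1 e + b * ω.2 e) * f ω.1) =
      fun ω => a * (ω.1 e * f ω.1) + b * (f ω.1 * ω.2 e) := by ext ω; ring
  rw [heq]
  refine ⟨h1.add h2, ?_⟩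
  rw [integral_add h1 h2, integral_const_mul, integral_const_mul]
  have h3 : ∫ ω : (ι → ℝ) × (ι → ℝ), f ω.1 * ω.2 e ∂pairGauss ι = 0 := by
    rw [pairGauss, integral_prod_mul (f := f) (g := fun J : ι → ℝ => J e),
      integral_eval_gaussianPi, mul_zero]
  have h4 := integral_fun_fst (μ := gaussianPi ι) (ν := gaussianPi ι) fun J : ι → ℝ => J e * f J
  rw [h3, pairGauss, h4]
  simp

/-- For bounded continuous `f`, the increments of the disorder and of `f` along the perturbation
have covariance `2 (1 - e^{-t})` times that of `J e` and `f J`. -/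
lemma integral_sub_mul_sub_contPerturb (hf : Continuous f) (hb : ∀ J, |f J| ≤ 1) (e : ι)
    {t : ℝ} (ht : 0 ≤ t) :
    Integrable (fun ω : (ι → ℝ) × (ι → ℝ) => (ω.1 e - contPerturb t ω.1 ω.2 e) *
      (f ω.1 - f (contPerturb t ω.1 ω.2))) (pairGauss ι) ∧
    ∫ ω : (ι → ℝ) × (ι → ℝ), (ω.1 e - contPerturb t ω.1 ω.2 e) *
      (f ω.1 - f (contPerturb t ω.1 ω.2)) ∂pairGauss ι =
      2 * (1 - Real.exp (-t)) * ∫ J, J e * f J ∂gaussianPi ι := by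
  set θ := Real.arccos (Real.exp (-t)) with hθ
  have h1 : Real.exp (-t) ≤ 1 := Real.exp_le_one_iff.2 (by linarith)
  have hcos : Real.cos θ = Real.exp (-t) :=
    Real.cos_arccos (by linarith [Real.exp_pos (-t)]) h1
  obtain ⟨hAi, hA⟩ := integral_linearComb_mul hf hb e (1 - Real.exp (-t))
    (-Real.sqrt (1 - Real.exp (-2 * t)))
  obtain ⟨hBi, hB⟩ := integral_linearComb_mul hf hb e (Real.exp (-t) - 1) (-Real.sin θ)
  have hrot := map_rotation_pairGauss (ι := ι) θ
  have hBi' := (hrot.integrable_comp hBi.aestronglyMeasurable).2 hBi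
  have hB' := integral_map (φ := ContinuousLinearMap.rotation θ) (μ := pairGauss ι)
    hrot.measurable.aemeasurable (hrot.map_eq.symm ▸ hBi.aestronglyMeasurable)
  rw [hrot.map_eq, hB] at hB'
  have hpt : ∀ ω : (ι → ℝ) × (ι → ℝ), ((Real.exp (-t) - 1) *
      (ContinuousLinearMap.rotation θ ω).1 e + -Real.sin θ *
      (ContinuousLinearMap.rotation θ ω).2 e) * f (ContinuousLinearMap.rotation θ ω).1 =
      (ω.1 e - contPerturb t ω.1 ω.2 e) * f (contPerturb t ω.1 ω.2) := fun ω => by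
    rw [rotation_arccos_fst ht ω, ← rotation_arccos_fst ht ω, ← hθ]
    congr 1
    simp only [ContinuousLinearMap.rotation_apply, Pi.add_apply, Pi.smul_apply, smul_eq_mul,
      ← hcos]
    linear_combination ω.1 e * Real.sin_sq_add_cos_sq θ
  have hBi'' : Integrable (fun ω : (ι → ℝ) × (ι → ℝ) =>
      (ω.1 e - contPerturb t ω.1 ω.2 e) * f (contPerturb t ω.1 ω.2)) (pairGauss ι) :=
    hBi'.congr (ae_of_all _ hpt)
  simp only [hpt] at hB'
  have hAeq : (fun ω : (ι → ℝ) × (ι → ℝ) => ((1 - Real.exp (-t)) * ω.1 e +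
      -Real.sqrt (1 - Real.exp (-2 * t)) * ω.2 e) * f ω.1) =
      fun ω => (ω.1 e - contPerturb t ω.1 ω.2 e) * f ω.1 := by
    ext ω; simp only [contPerturb]; ring
  rw [hAeq] at hAi hA
  simp only [mul_sub (_ - contPerturb _ _ _ _)]
  refine ⟨hAi.sub hBi'', ?_⟩
  rw [integral_sub hAi hBi'', hA, ← hB']
  ring

end Gaussian

lemma contPerturb_zero {ι : Type*} (J J' : ι → ℝ) : contPerturb 0 J J' = J := by
  ext e; simp [contPerturb]

section Model

variable (Edges : Finset (Finset (Fin N))) (β : ℝ)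

/-- The average `⟨σ_e⟩` as a function of the Gaussian disorder. -/
def edgeMean (e : Finset (Fin N)) (J : Finset (Fin N) → ℝ) : ℝ :=
  gibbs β (ham Edges (fun _ x => x) J) fun σ => sigEdge σ e

lemma continuous_ham (σ : Fin N → Bool) :
    Continuous fun J => ham Edges (fun _ x => x) J σ := by
  unfold ham; fun_prop

lemma continuous_edgeMean (e : Finset (Fin N)) : Continuous (edgeMean Edges β e) := by
  have := continuous_ham Edges
  unfold edgeMean gibbs
  exact Continuous.div (by fun_prop) (by fun_prop) fun J => (sum_exp_pos β _).ne'

lemma abs_edgeMean_le_one (e : Finset (Fin N)) (J : Finset (Fin N) → ℝ) :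
    |edgeMean Edges β e J| ≤ 1 :=
  abs_gibbs_le_one β _ fun σ => (abs_sigEdge σ e).le

lemma gibbs_ham_sub (J K L : Finset (Fin N) → ℝ) :
    gibbs β (ham Edges (fun _ x => x) L)
        (fun σ => ham Edges (fun _ x => x) J σ - ham Edges (fun _ x => x) K σ) =
      ∑ e ∈ Edges, (J e - K e) * edgeMean Edges β e L := by
  simp only [edgeMean, gibbs_eq_sum, ham, ← Finset.sum_sub_distrib, Finset.sum_mul, Finset.mul_sum]
  rw [Finset.sum_comm]
  refine Finset.sum_congr rfl fun e _ => Finset.sum_congr rfl fun σ _ => ?_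
  ring

/-- `⟨R(σ,τ)²⟩` for replicas with disorders `J` and `K`. -/
def overlapSq (J K : Finset (Fin N) → ℝ) : ℝ :=
  gibbs2 β (ham Edges (fun _ x => x) J) (ham Edges (fun _ x => x) K)
    (fun σ τ => overlap σ τ ^ 2)

lemma overlapSq_add_sub_le (hN : 1 ≤ N) (J K : Finset (Fin N) → ℝ) :
    overlapSq Edges β J J + overlapSq Edges β K K - 2 * overlapSq Edges β J K ≤
      2 * (β * ∑ e ∈ Edges, (J e - K e) * (edgeMean Edges β e J - edgeMean Edges β e K)) := by
  refine (gibbs2_overlap_sq_add_sub_le hN _ _ _).trans (le_of_eq ?_)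
  rw [gibbs_ham_sub, gibbs_ham_sub, ← Finset.sum_sub_distrib]
  simp only [mul_sub (_ - K _)]

lemma continuous_overlapSq {X : Type*} [TopologicalSpace X] {F G : X → Finset (Fin N) → ℝ}
    (hF : Continuous F) (hG : Continuous G) :
    Continuous fun x => overlapSq Edges β (F x) (G x) := by
  have h1 : ∀ σ, Continuous fun x => ham Edges (fun _ x => x) (F x) σ :=
    fun σ => (continuous_ham Edges σ).comp hF
  have h2 : ∀ σ, Continuous fun x => ham Edges (fun _ x => x) (G x) σ :=
    fun σ => (continuous_ham Edges σ).comp hG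
  unfold overlapSq gibbs2
  refine Continuous.div (by fun_prop) (by fun_prop) fun J => ne_of_gt ?_
  exact Finset.sum_pos (fun _ _ => Finset.sum_pos (fun _ _ => Real.exp_pos _)
    Finset.univ_nonempty) Finset.univ_nonempty

lemma continuous_contPerturb {ι : Type*} (t : ℝ) :
    Continuous fun ω : (ι → ℝ) × (ι → ℝ) => contPerturb t ω.1 ω.2 := by
  unfold contPerturb; fun_prop

lemma integrable_overlapSq (hN : 1 ≤ N)
    {F G : (Finset (Fin N) → ℝ) × (Finset (Fin N) → ℝ) → Finset (Fin N) → ℝ}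
    (hF : Continuous F) (hG : Continuous G) :
    Integrable (fun ω => overlapSq Edges β (F ω) (G ω)) (pairGauss (Finset (Fin N))) := by
  have : IsProbabilityMeasure (pairGauss (Finset (Fin N))) := by
    unfold pairGauss; infer_instance
  refine Integrable.of_bound
    (continuous_overlapSq Edges β hF hG).aestronglyMeasurable 1 (ae_of_all _ fun ω => ?_)
  rw [Real.norm_eq_abs, overlapSq, abs_of_nonneg (gibbs2_overlap_sq_nonneg _ _ _)]
  exact gibbs2_overlap_sq_le_one hN _ _ _

lemma contExp_overlap_sq_eq (t : ℝ) :
    contExp Edges (fun _ x => x) β t (fun σ τ => overlap σ τ ^ 2) =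
      ∫ ω : (Finset (Fin N) → ℝ) × (Finset (Fin N) → ℝ),
        overlapSq Edges β ω.1 (contPerturb t ω.1 ω.2) ∂pairGauss (Finset (Fin N)) := rfl

lemma contExp_overlap_sq_nonneg (t : ℝ) :
    0 ≤ contExp Edges (fun _ x => x) β t (fun σ τ => overlap σ τ ^ 2) :=
  integral_nonneg fun _ => gibbs2_overlap_sq_nonneg _ _ _

lemma contExp_zero_overlap_sq_mem (hN : 1 ≤ N) :
    0 < contExp Edges (fun _ x => x) β 0 (fun σ τ => overlap σ τ ^ 2) ∧
    contExp Edges (fun _ x => x) β 0 (fun σ τ => overlap σ τ ^ 2) ≤ 1 := by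
  have : IsProbabilityMeasure (pairGauss (Finset (Fin N))) := by
    unfold pairGauss; infer_instance
  have hi := integrable_overlapSq Edges β hN
    continuous_fst (continuous_contPerturb (ι := Finset (Fin N)) 0)
  have hN' : (0 : ℝ) < N := by exact_mod_cast hN
  rw [contExp_overlap_sq_eq]
  constructor
  · refine (inv_pos.2 hN').trans_le ?_
    have := integral_mono (integrable_const (N : ℝ)⁻¹) hi fun ω => by
      dsimp only
      rw [contPerturb_zero]
      exact inv_le_gibbs2_overlap_sq_self hN _ _
    simpa using this
  · have := integral_mono hi (integrable_const (1 : ℝ)) fun ω =>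
      gibbs2_overlap_sq_le_one hN _ _ _
    simpa using this

lemma contExp_zero_sub_contExp_le (hN : 1 ≤ N) (hβ : 0 ≤ β) {t : ℝ} (ht : 0 ≤ t) :
    contExp Edges (fun _ x => x) β 0 (fun σ τ => overlap σ τ ^ 2) -
      contExp Edges (fun _ x => x) β t (fun σ τ => overlap σ τ ^ 2) ≤
      2 * (t * β * Edges.card) := by
  have hc := continuous_contPerturb (ι := Finset (Fin N)) t
  have i1 := integrable_overlapSq Edges β hN continuous_fst continuous_fst
  have i2 := integrable_overlapSq Edges β hN hc hc
  have i3 := integrable_overlapSq Edges β hN continuous_fst hc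
  have i12 : Integrable (fun ω : (Finset (Fin N) → ℝ) × (Finset (Fin N) → ℝ) =>
      overlapSq Edges β ω.1 ω.1 +
        overlapSq Edges β (contPerturb t ω.1 ω.2) (contPerturb t ω.1 ω.2))
      (pairGauss (Finset (Fin N))) := i1.add i2
  have hE0 : contExp Edges (fun _ x => x) β 0 (fun σ τ => overlap σ τ ^ 2) =
      ∫ ω : (Finset (Fin N) → ℝ) × (Finset (Fin N) → ℝ),
        overlapSq Edges β ω.1 ω.1 ∂pairGauss (Finset (Fin N)) := by
    simp only [contExp_overlap_sq_eq, contPerturb_zero]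
  have hdiag : Continuous fun J : Finset (Fin N) → ℝ => overlapSq Edges β J J :=
    continuous_overlapSq Edges β continuous_id continuous_id
  have hE0' : ∫ ω : (Finset (Fin N) → ℝ) × (Finset (Fin N) → ℝ),
      overlapSq Edges β (contPerturb t ω.1 ω.2) (contPerturb t ω.1 ω.2)
        ∂pairGauss (Finset (Fin N)) =
      ∫ ω : (Finset (Fin N) → ℝ) × (Finset (Fin N) → ℝ),
        overlapSq Edges β ω.1 ω.1 ∂pairGauss (Finset (Fin N)) := by
    rw [integral_comp_contPerturb ht hdiag, pairGauss,
      integral_fun_fst (μ := gaussianPi (Finset (Fin N))) (ν := gaussianPi (Finset (Fin N)))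
        fun J => overlapSq Edges β J J]
    simp
  have hcov := fun e => integral_sub_mul_sub_contPerturb (continuous_edgeMean Edges β e)
    (abs_edgeMean_le_one Edges β e) e ht
  have key : ∫ ω : (Finset (Fin N) → ℝ) × (Finset (Fin N) → ℝ),
      (overlapSq Edges β ω.1 ω.1 +
        overlapSq Edges β (contPerturb t ω.1 ω.2) (contPerturb t ω.1 ω.2) -
        2 * overlapSq Edges β ω.1 (contPerturb t ω.1 ω.2)) ∂pairGauss (Finset (Fin N)) ≤
      ∫ ω : (Finset (Fin N) → ℝ) × (Finset (Fin N) → ℝ),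
        2 * (β * ∑ e ∈ Edges, (ω.1 e - contPerturb t ω.1 ω.2 e) *
          (edgeMean Edges β e ω.1 - edgeMean Edges β e (contPerturb t ω.1 ω.2)))
        ∂pairGauss (Finset (Fin N)) := by
    refine integral_mono (i12.sub (i3.const_mul 2))
      (((integrable_finsetSum _ fun e _ => (hcov e).1).const_mul β).const_mul 2) fun ω => ?_
    exact overlapSq_add_sub_le Edges β hN _ _
  rw [integral_sub i12 (i3.const_mul 2), integral_add i1 i2, integral_const_mul,
    integral_const_mul, integral_const_mul, integral_finsetSum _ fun e _ => (hcov e).1,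
    hE0', ← hE0, ← contExp_overlap_sq_eq] at key
  have hexp : 1 - Real.exp (-t) ≤ t := by linarith [Real.add_one_le_exp (-t)]
  have hexp0 : 0 ≤ 1 - Real.exp (-t) := by
    linarith [Real.exp_le_one_iff.2 (show -t ≤ 0 by linarith)]
  have hsum : ∑ e ∈ Edges, ∫ ω : (Finset (Fin N) → ℝ) × (Finset (Fin N) → ℝ),
      (ω.1 e - contPerturb t ω.1 ω.2 e) *
        (edgeMean Edges β e ω.1 - edgeMean Edges β e (contPerturb t ω.1 ω.2))
        ∂pairGauss (Finset (Fin N)) ≤ Edges.card * (2 * t) := by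
    rw [← nsmul_eq_mul]
    refine Finset.sum_le_card_nsmul _ _ _ fun e _ => ?_
    rw [(hcov e).2]
    have := integral_eval_mul_le_one (continuous_edgeMean Edges β e)
      (abs_edgeMean_le_one Edges β e) e
    nlinarith
  have := mul_le_mul_of_nonneg_left hsum hβ
  linarith

end Model

/-- Gaussian disorder, continuous perturbation, `β > 0`:
`E⟨R(σ,τ)²⟩_t ≥ E⟨R(σ,τ)²⟩_0 − 6 √t √β |E|^{3/4}`, and in particular if
`t ≤ 12⁻² β⁻¹ |E|^{-3/2} (E⟨R(σ¹,σ²)²⟩)²` then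
`E⟨R(σ,τ)²⟩_t > (1/2) E⟨R(σ¹,σ²)²⟩`, where `E⟨R(σ¹,σ²)²⟩ = E⟨R(σ,τ)²⟩_0`. -/
theorem stmt19
    (N Δ : ℕ) (hN : 1 ≤ N) (hΔ : 2 ≤ Δ)
    (Edges : Finset (Finset (Fin N)))
    (hcard : ∀ e ∈ Edges, 2 ≤ e.card ∧ e.card ≤ Δ)
    (β : ℝ) (hβ : 0 < β) (t : ℝ) (ht : 0 ≤ t) :
    contExp Edges (fun _ x => x) β 0 (fun σ τ => overlap σ τ ^ 2) -
          6 * Real.sqrt t * Real.sqrt β * (Edges.card : ℝ) ^ ((3 : ℝ) / 4)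
        ≤ contExp Edges (fun _ x => x) β t (fun σ τ => overlap σ τ ^ 2) ∧
      (t ≤ ((12 : ℝ) ^ 2)⁻¹ * β⁻¹ * (Edges.card : ℝ) ^ (-(3 : ℝ) / 2) *
          (contExp Edges (fun _ x => x) β 0 (fun σ τ => overlap σ τ ^ 2)) ^ 2 →
        (1 / 2) * contExp Edges (fun _ x => x) β 0 (fun σ τ => overlap σ τ ^ 2)
          < contExp Edges (fun _ x => x) β t (fun σ τ => overlap σ τ ^ 2)) := by
  set E₀ := contExp Edges (fun _ x => x) β 0 (fun σ τ => overlap σ τ ^ 2) with hE₀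
  set Et := contExp Edges (fun _ x => x) β t (fun σ τ => overlap σ τ ^ 2) with hEt
  obtain ⟨h0, h1⟩ : 0 < E₀ ∧ E₀ ≤ 1 := contExp_zero_overlap_sq_mem Edges β hN
  have hEt0 : 0 ≤ Et := contExp_overlap_sq_nonneg Edges β t
  have hD : E₀ - Et ≤ 2 * (t * β * Edges.card) := contExp_zero_sub_contExp_le Edges β hN hβ.le ht
  set s := Real.sqrt t * Real.sqrt β * (Edges.card : ℝ) ^ ((3 : ℝ) / 4) with hs
  have hs0 : 0 ≤ s := by positivity
  have hpow : ((Edges.card : ℝ) ^ ((3 : ℝ) / 4)) ^ 2 = (Edges.card : ℝ) ^ ((3 : ℝ) / 2) := by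
    rw [← Real.rpow_mul_natCast (by positivity)]; norm_num
  have hs2 : s ^ 2 = t * β * (Edges.card : ℝ) ^ ((3 : ℝ) / 2) := by
    rw [hs, mul_pow, mul_pow, Real.sq_sqrt ht, Real.sq_sqrt hβ.le, hpow]
  have hcard' : (Edges.card : ℝ) ≤ (Edges.card : ℝ) ^ ((3 : ℝ) / 2) := by
    rcases Nat.eq_zero_or_pos Edges.card with h | h
    · simp [h]
    · exact Real.self_le_rpow_of_one_le (by exact_mod_cast h) (by norm_num)
  have hD2 : E₀ - Et ≤ 2 * s := by
    have : E₀ - Et ≤ 2 * s ^ 2 := by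
      rw [hs2]
      exact hD.trans (by gcongr)
    by_contra! hlt
    nlinarith
  refine ⟨by nlinarith, fun hle => ?_⟩
  have hsE : s ^ 2 ≤ (E₀ / 12) ^ 2 := by
    rcases Nat.eq_zero_or_pos Edges.card with h | h
    · rw [hs2, h]; simp; positivity
    · have hm : (0 : ℝ) < (Edges.card : ℝ) ^ ((3 : ℝ) / 2) := by positivity
      rw [hs2]
      rw [neg_div, Real.rpow_neg (by positivity)] at hle
      calc t * β * (Edges.card : ℝ) ^ ((3 : ℝ) / 2) ≤
          (((12 : ℝ) ^ 2)⁻¹ * β⁻¹ * ((Edges.card : ℝ) ^ ((3 : ℝ) / 2))⁻¹ * E₀ ^ 2) * β *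
            (Edges.card : ℝ) ^ ((3 : ℝ) / 2) := by gcongr
        _ = (E₀ / 12) ^ 2 := by field_simp
  have := abs_le_of_sq_le_sq' hsE (by positivity)
  linarith [this.2]
end
end
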